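/- For every odd prime ℓ < 100, every ε ∈ {1, −1}, every odd prime p, and every integer y, we have y² ≠ 5·p^{22} + 4εℓ. -/

import Mathlib

/-- `u` agrees with `1 + 3 ^ k * t` modulo `3 ^ (k + 1)`. -/
def LeadTerm {R : Type*} [CommRing R] (k : ℕ) (t u : R) : Prop :=
  (3 : R) ^ (k + 1) ∣ u - (1 + 3 ^ k * t)

namespace LeadTerm

variable {R : Type*} [CommRing R] {k m : ℕ} {t t' u u' : R}

theorem one (k : ℕ) : LeadTerm k (0 : R) 1 := by simp [LeadTerm]

theorem mul (hk : 1 ≤ k) (h : LeadTerm k t u) (h' : LeadTerm k t' u') :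
    LeadTerm k (t + t') (u * u') := by
  obtain ⟨r, hr⟩ := h
  obtain ⟨r', hr'⟩ := h'
  obtain ⟨k, rfl⟩ := Nat.exists_eq_add_of_le' hk
  rw [sub_eq_iff_eq_add] at hr hr'
  refine ⟨3 ^ k * t * t' + r * (1 + 3 ^ (k + 1) * t') + r' * (1 + 3 ^ (k + 1) * t) +
    3 ^ (k + 2) * r * r', ?_⟩
  rw [hr, hr']
  ring

theorem inv (hk : 1 ≤ k) (huv : u * u' = 1) (h : LeadTerm k t u) : LeadTerm k (-t) u' := by
  obtain ⟨r, hr⟩ := h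
  obtain ⟨k, rfl⟩ := Nat.exists_eq_add_of_le' hk
  rw [sub_eq_iff_eq_add] at hr
  refine ⟨u' * (3 ^ k * t ^ 2 - r * (1 - 3 ^ (k + 1) * t)), ?_⟩
  subst hr
  linear_combination (1 - 3 ^ (k + 1) * t) * huv

theorem pow (hk : 1 ≤ k) (h : LeadTerm k t u) (n : ℕ) : LeadTerm k (n * t) (u ^ n) := by
  induction n with
  | zero => simpa using one k
  | succ n ih =>
    have := ih.mul hk h
    rwa [← pow_succ, show (n : R) * t + t = ((n + 1 : ℕ) : R) * t by push_cast; ring] at this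

theorem zpow (hk : 1 ≤ k) {u : Rˣ} (h : LeadTerm k t (u : R)) (n : ℤ) :
    LeadTerm k (n * t) ((u ^ n : Rˣ) : R) := by
  obtain ⟨n, rfl | rfl⟩ := n.eq_nat_or_neg
  · simpa using h.pow hk n
  · have := (h.pow hk n).inv hk (u' := (((u ^ n)⁻¹ : Rˣ) : R)) (by
      rw [← Units.val_pow_eq_pow_val, Units.mul_inv])
    simpa using this

theorem cube (hk : 1 ≤ k) (h : LeadTerm k t u) : LeadTerm (k + 1) t (u ^ 3) := by
  obtain ⟨r, hr⟩ := h
  obtain ⟨k, rfl⟩ := Nat.exists_eq_add_of_le' hk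
  rw [sub_eq_iff_eq_add] at hr
  refine ⟨r + 3 ^ k * (t + 3 * r) ^ 2 + 3 ^ (2 * k) * (t + 3 * r) ^ 3, ?_⟩
  subst hr
  ring

theorem pow_three_pow (hk : 1 ≤ k) (h : LeadTerm k t u) (j : ℕ) :
    LeadTerm (k + j) t (u ^ 3 ^ j) := by
  induction j with
  | zero => simpa using h
  | succ j ih =>
    rw [pow_succ, pow_mul]
    have hkj : 1 ≤ k + j := by omega
    exact ih.cube hkj

theorem of_lt (hmk : m < k) (h : LeadTerm k t u) : LeadTerm m (0 : R) u := by
  obtain ⟨r, hr⟩ := h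
  obtain ⟨k, rfl⟩ := Nat.exists_eq_add_of_lt hmk
  refine ⟨3 ^ k * t + 3 ^ (k + 1) * r, ?_⟩
  rw [sub_eq_iff_eq_add] at hr
  subst hr
  ring

theorem zpow_three_pow_mul (hk : 1 ≤ k) {u : Rˣ} (h : LeadTerm k t (u : R)) (j : ℕ) (c : ℤ) :
    LeadTerm (k + j) (c * t) ((u ^ ((3 : ℤ) ^ j * c) : Rˣ) : R) := by
  rw [zpow_mul]
  refine zpow (by omega) ?_ c
  have := h.pow_three_pow hk j
  rw [← Units.val_pow_eq_pow_val] at this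
  convert this using 2
  norm_cast

theorem prod {ι : Type*} (s : Finset ι) (hk : 1 ≤ k) (t u : ι → R)
    (h : ∀ i ∈ s, LeadTerm k (t i) (u i)) : LeadTerm k (∑ i ∈ s, t i) (∏ i ∈ s, u i) := by
  classical
  induction s using Finset.induction_on with
  | empty => simpa using one k
  | insert i s hi ih =>
    rw [Finset.sum_insert hi, Finset.prod_insert hi]
    exact (h i (by simp)).mul hk (ih fun j hj => h j (by simp [hj]))

/-- Units whose leading terms are independent modulo `3` are multiplicatively independent. -/
theorem eq_zero_of_prod_zpow_eq_one [IsDomain R] [CharZero R] {ι : Type*} [Fintype ι]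
    (k : ι → ℕ) (hk : ∀ i, 1 ≤ k i) (t : ι → R) (u : ι → Rˣ)
    (h : ∀ i, LeadTerm (k i) (t i) (u i : R))
    (hind : ∀ c : ι → ℤ, (3 : R) ∣ ∑ i, (c i : R) * t i → ∀ i, 3 ∣ c i)
    (e : ι → ℤ) (he : ∏ i, u i ^ e i = 1) : e = 0 := by
  classical
  by_contra hne
  obtain ⟨i₁, hi₁⟩ := Function.ne_iff.mp hne
  have key : ∀ i, ∃ (j : ℕ) (c : ℤ), e i = 3 ^ j * c ∧ (e i ≠ 0 → ¬ 3 ∣ c) := by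
    intro i
    by_cases hi : e i = 0
    · exact ⟨0, 0, by simp [hi], fun h => absurd hi h⟩
    · obtain ⟨c, hc, hc'⟩ :=
        (Int.finiteMultiplicity_iff.mpr ⟨by decide, hi⟩ :
          FiniteMultiplicity (3 : ℤ) (e i)).exists_eq_pow_mul_and_not_dvd
      exact ⟨_, c, hc, fun _ => hc'⟩
  choose j c hjc hc using key
  obtain ⟨i₀, hi₀, hmin⟩ := Finset.exists_min_image (Finset.univ.filter fun i => e i ≠ 0)
    (fun i => k i + j i) ⟨i₁, by simpa using hi₁⟩
  simp only [Finset.mem_filter, Finset.mem_univ, true_and] at hi₀ hmin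
  set m := k i₀ + j i₀ with hm
  have hm1 : 1 ≤ m := by have := hk i₀; omega
  let c' : ι → ℤ := fun i => if e i ≠ 0 ∧ k i + j i = m then c i else 0
  have hlead : ∀ i ∈ Finset.univ, LeadTerm m ((c' i : R) * t i) ((u i ^ e i : Rˣ) : R) := by
    intro i _
    by_cases hi : e i = 0
    · simpa [c', hi] using one m
    · have h1 := (h i).zpow_three_pow_mul (hk i) (j i) (c i)
      rw [← hjc i] at h1
      by_cases him : k i + j i = m
      · simpa [c', hi, him] using him ▸ h1
      · have := h1.of_lt (m := m) (by have := hmin i hi; omega)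
        simpa [c', hi, him] using this
  have hprod := prod Finset.univ hm1 _ _ hlead
  have h1 : ∏ i, ((u i ^ e i : Rˣ) : R) = 1 := by
    rw [← Units.coe_prod, he, Units.val_one]
  rw [h1] at hprod
  obtain ⟨r, hr⟩ := hprod
  have hdvd : (3 : R) ∣ ∑ i, (c' i : R) * t i := by
    refine ⟨-r, ?_⟩
    have h3 : (3 : R) ^ m ≠ 0 := pow_ne_zero _ (by norm_num)
    apply mul_left_cancel₀ h3
    linear_combination -hr
  have := hind c' hdvd i₀
  simp only [c', hi₀, ne_eq, not_false_eq_true, true_and, ← hm, if_true] at this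
  exact hc i₀ hi₀ this

end LeadTerm

/-! ### Integer polynomials as coefficient lists -/

namespace CoeffList

/-- The value at `x` of the polynomial with coefficients `l`, constant term first. -/
def value {R : Type*} [CommRing R] (x : R) : List ℤ → R
  | [] => 0
  | a :: l => a + x * value x l

/-- Sum of two polynomials. -/
def add : List ℤ → List ℤ → List ℤ
  | [], m => m
  | a :: l, [] => a :: l
  | a :: l, b :: m => (a + b) :: add l m

/-- Multiplication of a polynomial by a scalar. -/
def smul (c : ℤ) (l : List ℤ) : List ℤ := l.map (c * ·)

/-- Product of two polynomials. -/
def mul : List ℤ → List ℤ → List ℤ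
  | [], _ => []
  | a :: l, m => add (smul a m) (0 :: mul l m)

/-- Multiplication by the variable modulo `X ^ 11 = r`. -/
def mulX (r l : List ℤ) : List ℤ := add (0 :: l.take 10) (mul (l.drop 10) r)

/-- Multiplication modulo `X ^ 11 = r`. -/
def mulMod (r : List ℤ) : List ℤ → List ℤ → List ℤ
  | [], _ => []
  | a :: l, m => add (smul a m) (mulX r (mulMod r l m))

/-- Composition `l(g)` modulo `X ^ 11 = r`. -/
def compMod (r g : List ℤ) : List ℤ → List ℤ
  | [] => []
  | a :: l => add [a] (mulMod r g (compMod r g l))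

/-- Scaling of the roots of a polynomial by `d`. -/
def dilate (d : ℤ) : List ℤ → List ℤ
  | [] => []
  | a :: l => a * d ^ l.length :: dilate d l

/-- Reduction of the coefficients modulo `n`. -/
def red (n : ℤ) (l : List ℤ) : List ℤ := l.map (· % n)

/-- The cube modulo `X ^ 11 = r` and modulo `n`. -/
def cubeMod (n : ℤ) (r l : List ℤ) : List ℤ := red n (mulMod r l (red n (mulMod r l l)))

/-- All coefficients are divisible by `n`. -/
def allDvd (n : ℤ) (l : List ℤ) : Bool := l.all (· % n == 0)

section value

variable {R : Type*} [CommRing R] (x : R)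

@[simp] theorem value_nil : value x [] = 0 := rfl

@[simp] theorem value_cons (a : ℤ) (l : List ℤ) : value x (a :: l) = a + x * value x l := rfl

@[simp] theorem value_add (l m : List ℤ) : value x (add l m) = value x l + value x m := by
  induction l generalizing m with
  | nil => simp [add]
  | cons a l ih =>
    cases m with
    | nil => simp [add]
    | cons b m => simp [add, ih]; ring

@[simp] theorem value_smul (c : ℤ) (l : List ℤ) : value x (smul c l) = c * value x l := by
  induction l with
  | nil => simp [smul]
  | cons a l ih =>
    rw [smul, List.map_cons, value_cons, ← smul, ih, value_cons]
    push_cast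
    ring

@[simp] theorem value_mul (l m : List ℤ) : value x (mul l m) = value x l * value x m := by
  induction l with
  | nil => simp [mul]
  | cons a l ih => simp [mul, ih]; ring

theorem value_take_drop (n : ℕ) (l : List ℤ) :
    value x (l.take n) + x ^ n * value x (l.drop n) = value x l := by
  induction n generalizing l with
  | zero => simp
  | succ n ih =>
    cases l with
    | nil => simp
    | cons a l =>
      simp only [List.take_succ_cons, List.drop_succ_cons, value_cons, ← ih l]
      ring

theorem value_append (l m : List ℤ) : value x (l ++ m) = value x l + x ^ l.length * value x m := by
  induction l with
  | nil => simp
  | cons a l ih => simp [ih]; ring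

theorem map_value {S F : Type*} [CommRing S] [FunLike F R S] [RingHomClass F R S] (φ : F)
    (l : List ℤ) : φ (value x l) = value (φ x) l := by
  induction l with
  | nil => simp
  | cons a l ih => simp [ih]

variable {x} {r : List ℤ}

theorem value_mulX (hx : x ^ 11 = value x r) (l : List ℤ) : value x (mulX r l) = x * value x l := by
  rw [mulX, value_add, value_mul, ← value_take_drop x 10 l, value_cons, ← hx]
  push_cast
  ring

theorem value_mulMod (hx : x ^ 11 = value x r) (l m : List ℤ) :
    value x (mulMod r l m) = value x l * value x m := by
  induction l with
  | nil => simp [mulMod]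
  | cons a l ih => simp [mulMod, value_mulX hx, ih]; ring

theorem value_compMod (hx : x ^ 11 = value x r) (g l : List ℤ) :
    value x (compMod r g l) = value (value x g) l := by
  induction l with
  | nil => simp [compMod]
  | cons a l ih => simp [compMod, value_mulMod hx, ih]

theorem value_dilate (d : ℤ) (l : List ℤ) :
    d * value (d * x) (dilate d l) = d ^ l.length * value x l := by
  induction l with
  | nil => simp [dilate]
  | cons a l ih =>
    simp only [dilate, value_cons, List.length_cons]
    push_cast
    linear_combination (d : R) * x * ih

theorem value_eq_zero_of_allDvd {n : ℤ} (hn : (n : R) = 0) {l : List ℤ} (h : allDvd n l = true) :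
    value x l = 0 := by
  induction l with
  | nil => simp
  | cons a l ih =>
    simp only [allDvd, List.all_cons, Bool.and_eq_true, beq_iff_eq] at h ih
    obtain ⟨c, rfl⟩ := Int.dvd_of_emod_eq_zero h.1
    simp [ih h.2, hn]

theorem value_red {n : ℤ} (hn : (n : R) = 0) (l : List ℤ) : value x (red n l) = value x l := by
  induction l with
  | nil => simp [red]
  | cons a l ih =>
    rw [red, List.map_cons, value_cons, ← red, ih, value_cons]
    congr 1
    conv_rhs => rw [← Int.emod_add_mul_ediv a n]
    push_cast
    simp [hn]

theorem value_cubeMod {n : ℤ} (hn : (n : R) = 0) (hx : x ^ 11 = value x r) (l : List ℤ) :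
    value x (cubeMod n r l) = value x l ^ 3 := by
  rw [cubeMod, value_red hn, value_mulMod hx, value_red hn, value_mulMod hx]
  ring

theorem value_iterate_cubeMod {n : ℤ} (hn : (n : R) = 0) (hx : x ^ 11 = value x r) (l : List ℤ)
    (j : ℕ) : value x ((cubeMod n r)^[j] l) = value x l ^ 3 ^ j := by
  induction j with
  | zero => simp
  | succ j ih =>
    rw [Function.iterate_succ_apply', value_cubeMod hn hx, ih, ← pow_mul, pow_succ]

end value

open Polynomial in
theorem coeff_value_X (l : List ℤ) (n : ℕ) : (value (X : ℤ[X]) l).coeff n = l.getD n 0 := by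
  induction l generalizing n with
  | nil => simp
  | cons a l ih =>
    rw [value_cons, ← C_eq_intCast]
    cases n with
    | zero => simp
    | succ n => rw [coeff_add, coeff_X_mul, coeff_C_succ, ih, zero_add, List.getD_cons_succ]

open Polynomial in
theorem degree_value_X_lt (l : List ℤ) : (value (X : ℤ[X]) l).degree < l.length := by
  rw [degree_lt_iff_coeff_zero]
  intro m hm
  rw [coeff_value_X, List.getD_eq_default _ _ (by exact_mod_cast hm)]

open Polynomial in
theorem isIntegral_of_pow_length_eq {R : Type*} [CommRing R] {x : R} {l : List ℤ}
    (h : x ^ l.length = value x l) : IsIntegral ℤ x := by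
  refine ⟨X ^ l.length - value X l, monic_X_pow_sub (degree_value_X_lt l), ?_⟩
  rw [eval₂_sub, eval₂_X_pow, h, sub_eq_zero]
  have := map_value (X : ℤ[X]) (eval₂RingHom (algebraMap ℤ R) x) l
  rw [coe_eval₂RingHom, eval₂_X] at this
  exact this.symm

/-- A unit `g(x) / den` of the order localised at `3`, with its equation `X ^ 11 = charpoly(X)`,
and the first coefficient `lead` of the expansion of its `3 ^ 10 - 1`-st power. -/
structure UnitData where
  g : List ℤ
  den : ℤ
  inv : ℤ
  charpoly : List ℤ
  lead : List ℤ

/-- The verification of the data of a unit. -/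
def UnitData.check (r : List ℤ) (u : UnitData) : Bool :=
  u.den * u.inv % 9 == 1 && u.charpoly.length == 11 && (u.charpoly.getD 0 0) ^ 2 == 1 &&
  allDvd 0 (compMod r u.g (dilate u.den (u.charpoly ++ [-1]))) &&
  allDvd 9 (add ((cubeMod 9 r)^[10] (red 9 (smul u.inv u.g)))
    (smul (-1) (mulMod r (red 9 (smul u.inv u.g)) (add [1] (smul 3 u.lead)))))

end CoeffList

open Polynomial CoeffList

/-- The elements of `K` which become integral polynomials in `x` after multiplication by an
integer prime to `3`. -/
def orderAtThree {K : Type*} [Field K] (x : K) : Subring K where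
  carrier := {e | ∃ m : ℤ, ¬ 3 ∣ m ∧ ∃ p : ℤ[X], m * e = aeval x p}
  zero_mem' := ⟨1, by decide, 0, by simp⟩
  one_mem' := ⟨1, by decide, 1, by simp⟩
  add_mem' := by
    rintro a b ⟨m, hm, p, hp⟩ ⟨n, hn, q, hq⟩
    refine ⟨m * n, fun h => (Int.prime_three.dvd_or_dvd h).elim hm hn,
      (n : ℤ[X]) * p + (m : ℤ[X]) * q, ?_⟩
    simp only [map_add, map_mul, map_intCast, ← hp, ← hq]
    push_cast
    ring
  mul_mem' := by
    rintro a b ⟨m, hm, p, hp⟩ ⟨n, hn, q, hq⟩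
    refine ⟨m * n, fun h => (Int.prime_three.dvd_or_dvd h).elim hm hn, p * q, ?_⟩
    simp only [map_mul, ← hp, ← hq]
    push_cast
    ring
  neg_mem' := by
    rintro a ⟨m, hm, p, hp⟩
    exact ⟨m, hm, -p, by simp [← hp]⟩

theorem value_mem_subring {K : Type*} [CommRing K] (S : Subring K) {e : K} (he : e ∈ S)
    (l : List ℤ) : value e l ∈ S := by
  induction l with
  | nil => simp
  | cons a l ih => exact S.add_mem (intCast_mem S a) (S.mul_mem he ih)

theorem mem_orderAtThree_self {K : Type*} [Field K] (x : K) : x ∈ orderAtThree x :=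
  ⟨1, by decide, X, by simp⟩

theorem UnitData.exists_unit {K : Type*} [Field K] [CharZero K] {x : K} {r : List ℤ}
    (hx : x ^ 11 = value x r) {u : UnitData} (h : u.check r = true) :
    ∃ e w : K, e * w = 1 ∧ IsIntegral ℤ e ∧ IsIntegral ℤ w ∧
      ∃ (he : e ∈ orderAtThree x) (_ : w ∈ orderAtThree x),
        LeadTerm 1 (value (⟨x, mem_orderAtThree_self x⟩ : orderAtThree x) u.lead)
          ((⟨e, he⟩ : orderAtThree x) ^ (3 ^ 10 - 1)) := by
  obtain ⟨g, d, i, P, a⟩ := u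
  simp only [UnitData.check, Bool.and_eq_true, beq_iff_eq] at h
  obtain ⟨⟨⟨⟨hd, hlen⟩, hP⟩, hroot⟩, hpow⟩ := h
  have hd3 : ¬ 3 ∣ d := by
    rintro ⟨c, rfl⟩
    rw [mul_assoc] at hd
    omega
  have hd0 : (d : K) ≠ 0 := by
    rw [Int.cast_ne_zero]; rintro rfl; simp at hd3
  set e : K := value x g / d with he
  have hde : d * e = value x g := mul_div_cancel₀ _ hd0
  have he_mem : e ∈ orderAtThree x := ⟨d, hd3, value X g, by rw [hde, map_value, aeval_X]⟩
  have hroot' : e ^ P.length = value e P := by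
    have h0 := value_eq_zero_of_allDvd (x := x) (by simp) hroot
    rw [value_compMod hx, ← hde] at h0
    have h1 := value_dilate (x := e) d (P ++ [-1])
    rw [h0, mul_zero, eq_comm, mul_eq_zero, or_iff_right (pow_ne_zero _ hd0), value_append] at h1
    simp only [value_cons, value_nil] at h1
    push_cast at h1
    linear_combination -h1
  have hint : IsIntegral ℤ e := isIntegral_of_pow_length_eq hroot'
  obtain ⟨p₀, P, rfl⟩ : ∃ p₀ P', P = p₀ :: P' := List.exists_cons_of_length_eq_add_one hlen
  have hp₀ : (p₀ : K) * p₀ = 1 := by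
    rw [List.getD_cons_zero] at hP
    exact_mod_cast (sq p₀) ▸ hP
  have hvalint : ∀ l, IsIntegral ℤ (value e l) := fun l => by
    have := value_mem_subring (integralClosure ℤ K).toSubring (e := e) hint l
    exact this
  set w : K := p₀ * (e ^ 10 - value e P) with hw
  have hew : e * w = 1 := by
    rw [hlen, value_cons] at hroot'
    rw [hw]
    linear_combination (p₀ : K) * hroot' + hp₀
  have hw_mem : w ∈ orderAtThree x :=
    Subring.mul_mem _ (intCast_mem _ _)
      (Subring.sub_mem _ (Subring.pow_mem _ he_mem _) (value_mem_subring _ he_mem _))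
  refine ⟨e, w, hew, hint, ?_, he_mem, hw_mem, ?_⟩
  · exact (isIntegral_algebraMap (R := ℤ) (x := p₀)).mul ((hint.pow 10).sub (hvalint P))
  -- the expansion of the power is computed modulo `9`
  set R := orderAtThree x
  set ξ : R := ⟨x, mem_orderAtThree_self x⟩
  set η : R := ⟨e, he_mem⟩
  let ω : R := ⟨w, hw_mem⟩
  have hξ : ξ ^ 11 = value ξ r := by
    apply Subtype.val_injective
    have := map_value ξ R.subtype r
    simpa [ξ, hx] using this.symm
  have hη : d * η = value ξ g := by
    apply Subtype.val_injective
    have := map_value ξ R.subtype g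
    simpa [ξ, η, hde] using this.symm
  have hηω : η * ω = 1 := Subtype.val_injective (by simpa [η, ω] using hew)
  let φ := Ideal.Quotient.mk (Ideal.span {(9 : R)})
  have h9 : ((9 : ℤ) : R ⧸ Ideal.span {(9 : R)}) = 0 := by
    have : φ 9 = 0 := Ideal.Quotient.eq_zero_iff_mem.mpr (Ideal.mem_span_singleton_self _)
    exact_mod_cast (map_ofNat φ 9).symm.trans this
  have hφξ : φ ξ ^ 11 = value (φ ξ) r := by rw [← map_pow, hξ, map_value]
  have hφη : φ η = value (φ ξ) (red 9 (smul i g)) := by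
    rw [value_red h9, value_smul, ← map_value, ← hη, map_mul, map_intCast, ← mul_assoc,
      ← Int.cast_mul,
      mul_comm i d, ← Int.emod_add_mul_ediv (d * i) 9, hd]
    push_cast at h9 ⊢
    rw [h9]
    ring
  have hz := value_eq_zero_of_allDvd (x := φ ξ) h9 hpow
  rw [value_add, value_iterate_cubeMod h9 hφξ, value_smul, value_mulMod hφξ, ← hφη] at hz
  have h1 : φ (η ^ (3 ^ 10 - 1)) = φ (1 + 3 ^ 1 * value ξ a) := by
    have h2 : φ η * φ ω = 1 := by rw [← map_mul, hηω, map_one]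
    have h3 : φ η ^ 3 ^ 10 = φ η ^ (3 ^ 10 - 1) * φ η := by
      rw [← pow_succ, Nat.sub_add_cancel (Nat.one_le_pow _ _ (by decide))]
    rw [h3] at hz
    simp only [map_pow, map_add, map_one, map_mul, map_ofNat, map_value]
    simp only [value_add, value_smul, value_cons, value_nil] at hz
    push_cast at hz
    generalize φ η ^ (3 ^ 10 - 1) = v at hz ⊢
    linear_combination (φ ω) * hz - (v - 1 - 3 * value (φ ξ) a) * h2
  rw [Ideal.Quotient.eq, Ideal.mem_span_singleton] at h1
  rw [LeadTerm]
  convert h1 using 1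
  norm_num

/-! ### Units of number fields of degree eleven -/

open NumberField in
theorem exists_prod_zpow_eq_one {K : Type*} [Field K] [NumberField K] {ι : Type*} [Fintype ι]
    (h : Units.rank K < Fintype.card ι) (u : ι → (𝓞 K)ˣ) :
    ∃ e : ι → ℤ, e ≠ 0 ∧ ∏ i, u i ^ e i = 1 := by
  have hv : ¬ LinearIndependent ℤ (fun i => Additive.ofMul (u i)) := fun hv => by
    have := hv.fintype_card_le_finrank
    rw [Units.finrank_eq] at this
    omega
  obtain ⟨e, he, i, hi⟩ := Fintype.not_linearIndependent_iff.mp hv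
  refine ⟨e, fun h0 => hi (congr_fun h0 i), Additive.ofMul.injective ?_⟩
  simpa only [ofMul_prod, ofMul_zpow, ofMul_one] using he

open NumberField in
theorem false_of_independent_units {K : Type*} [Field K] [NumberField K] {ι : Type*} [Fintype ι]
    (hrank : Units.rank K < Fintype.card ι) (S : Subring K) (v w : ι → S)
    (hvw : ∀ i, v i * w i = 1) (hv : ∀ i, IsIntegral ℤ (v i : K)) (hw : ∀ i, IsIntegral ℤ (w i : K))
    (k : ι → ℕ) (hk : ∀ i, 1 ≤ k i) (t : ι → S) (h : ∀ i, LeadTerm (k i) (t i) (v i))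
    (hind : ∀ c : ι → ℤ, (3 : S) ∣ ∑ i, (c i : S) * t i → ∀ i, 3 ∣ c i) : False := by
  have hvw' : ∀ i, (v i : K) * w i = 1 := fun i => by
    rw [← Subring.coe_mul, hvw, Subring.coe_one]
  let u : ι → (𝓞 K)ˣ := fun i => .mkOfMulEqOne ⟨v i, hv i⟩ ⟨w i, hw i⟩
    (RingOfIntegers.coe_injective (hvw' i))
  let s : ι → Sˣ := fun i => .mkOfMulEqOne (v i) (w i) (hvw i)
  obtain ⟨e, he, hprod⟩ := exists_prod_zpow_eq_one hrank u
  refine he (LeadTerm.eq_zero_of_prod_zpow_eq_one k hk t s h hind e ?_)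
  have hinj : Function.Injective (Units.map (S.subtype : S →* K)) :=
    Units.map_injective Subtype.val_injective
  apply hinj
  have h1 := congr_arg (Units.map (algebraMap (𝓞 K) K : 𝓞 K →* K)) hprod
  rw [map_prod, map_one] at h1 ⊢
  rw [← h1]
  refine Finset.prod_congr rfl fun i _ => ?_
  rw [map_zpow, map_zpow]
  congr 1

open NumberField in
theorem rank_eq_five {K : Type*} [Field K] [NumberField K] (hfin : Module.finrank ℚ K = 11)
    (x : K) (hx : ∀ φ ψ : K →+* ℂ, φ x = ψ x → φ = ψ)
    (huniq : ∀ φ ψ : K →+* ℝ, φ x = ψ x) : Units.rank K = 5 := by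
  classical
  have h1 := InfinitePlace.card_add_two_mul_card_eq_rank K
  have h2 := InfinitePlace.card_eq_nrRealPlaces_add_nrComplexPlaces K
  have h3 := InfinitePlace.card_real_embeddings K
  have h4 : Subsingleton {φ : K →+* ℂ // ComplexEmbedding.IsReal φ} := by
    refine ⟨fun ⟨φ, hφ⟩ ⟨ψ, hψ⟩ => Subtype.ext (hx φ ψ ?_)⟩
    rw [← hφ.coe_embedding_apply x, ← hψ.coe_embedding_apply x, huniq hφ.embedding hψ.embedding]
  have h5 := Fintype.card_le_one_iff_subsingleton.mpr h4
  rw [Units.rank]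
  omega

theorem orderAtThree.dvd_coeff {K : Type*} [Field K] {x : K} {f : ℤ[X]} (hf : f.Monic)
    (hdvd : ∀ p : ℤ[X], aeval x p = 0 → f ∣ p) {q : ℤ[X]} (hq : q.degree < f.degree)
    (h : (3 : orderAtThree x) ∣ aeval (⟨x, mem_orderAtThree_self x⟩ : orderAtThree x) q) (n : ℕ) :
    3 ∣ q.coeff n := by
  obtain ⟨⟨e, m, hm, p, hp⟩, he⟩ := h
  have hq' : aeval x q = 3 * e := by
    have h1 := congr_arg (algebraMap (orderAtThree x) K) he
    rwa [← aeval_algebraMap_apply] at h1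
  have h0 : f ∣ (m : ℤ[X]) * q - 3 * p := hdvd _ (by
    simp only [map_sub, map_mul, map_intCast, map_ofNat, hq', ← hp]
    ring)
  have h1 := Polynomial.map_dvd (Int.castRingHom (ZMod 3)) h0
  have h3 : (3 : (ZMod 3)[X]) = 0 := by exact_mod_cast CharP.cast_eq_zero (ZMod 3)[X] 3
  simp only [Polynomial.map_sub, Polynomial.map_mul, Polynomial.map_ofNat, h3, zero_mul, sub_zero,
    Polynomial.map_intCast] at h1
  have hm0 : (m : ZMod 3) ≠ 0 := fun h => hm ((ZMod.intCast_zmod_eq_zero_iff_dvd m 3).mp h)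
  have hu : IsUnit (m : (ZMod 3)[X]) := by
    rw [← C_eq_intCast]
    exact (IsUnit.mk0 _ hm0).map C
  rw [hu.dvd_mul_left] at h1
  have h2 : q.map (Int.castRingHom (ZMod 3)) = 0 := by
    by_contra hne
    refine (hf.map _).not_dvd_of_degree_lt hne ?_ h1
    rw [hf.degree_map]
    exact degree_map_le.trans_lt hq
  have h4 := congr_arg (fun q => q.coeff n) h2
  rw [coeff_map, coeff_zero, eq_intCast] at h4
  exact (ZMod.intCast_zmod_eq_zero_iff_dvd _ 3).mp h4

theorem three_dvd_of_dual {ι : Type*} [Fintype ι] [DecidableEq ι] {rows W : ι → List ℤ}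
    (hW : ∀ i j, (∑ n : Fin 11, (rows i).getD n 0 * (W j).getD n 0 -
      if i = j then 1 else 0) % 3 = 0)
    {c : ι → ℤ} (h : ∀ n, 3 ∣ ∑ i, c i * (rows i).getD n 0) (j : ι) : 3 ∣ c j := by
  have h1 : (3 : ℤ) ∣ ∑ n : Fin 11, (∑ i, c i * (rows i).getD n 0) * (W j).getD n 0 :=
    Finset.dvd_sum fun n _ => (h n).mul_right _
  have h2 : (3 : ℤ) ∣ ∑ i, c i * (∑ n : Fin 11, (rows i).getD n 0 * (W j).getD n 0 -
      if i = j then 1 else 0) :=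
    Finset.dvd_sum fun i _ => (Int.dvd_of_emod_eq_zero (hW i j)).mul_left _
  have h3 := dvd_sub h1 h2
  simp only [mul_sub, Finset.sum_sub_distrib, Finset.sum_mul, Finset.mul_sum] at h3
  rw [Finset.sum_comm] at h3
  simpa [mul_assoc] using h3

/-- The polynomial `X ^ 11 - r`. -/
noncomputable def definingPoly (r : List ℤ) : ℤ[X] := X ^ 11 - value X r

section

variable {r : List ℤ}

theorem degree_value_lt_eleven (hr : r.length = 11) : (value (X : ℤ[X]) r).degree < (11 : ℕ) :=
  by simpa only [hr] using degree_value_X_lt r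

theorem definingPoly_monic (hr : r.length = 11) : (definingPoly r).Monic :=
  monic_X_pow_sub (degree_value_lt_eleven hr)

theorem definingPoly_degree (hr : r.length = 11) : (definingPoly r).degree = (11 : ℕ) := by
  rw [definingPoly, degree_sub_eq_left_of_degree_lt, degree_X_pow]
  rw [degree_X_pow]
  exact degree_value_lt_eleven hr

/-- Eisenstein's criterion for `definingPoly`. -/
theorem definingPoly_irreducible (hr : r.length = 11) {q : ℤ} (hq : Prime q)
    (hdvd : allDvd q r = true) (h0 : ¬ q ^ 2 ∣ r.getD 0 0) : Irreducible (definingPoly r) := by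
  have hmonic := definingPoly_monic hr
  have hdeg := definingPoly_degree hr
  have hcoeff : ∀ n, n < 11 → (definingPoly r).coeff n = -r.getD n 0 := fun n hn => by
    rw [definingPoly, coeff_sub, coeff_X_pow, if_neg hn.ne, coeff_value_X, zero_sub]
  have hmem : ∀ n, q ∣ r.getD n 0 := by
    intro n
    rcases lt_or_ge n r.length with hn | hn
    · rw [List.getD_eq_getElem _ _ hn]
      have := List.all_eq_true.mp hdvd _ (List.getElem_mem hn)
      exact Int.dvd_of_emod_eq_zero (by simpa using this)
    · rw [List.getD_eq_default _ _ hn]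
      exact dvd_zero q
  refine irreducible_of_eisenstein_criterion (P := Ideal.span {q})
    ((Ideal.span_singleton_prime hq.ne_zero).mpr hq) ?_ ?_ ?_ ?_ hmonic.isPrimitive
  · rw [hmonic.leadingCoeff, Ideal.mem_span_singleton]
    exact fun h => hq.not_isUnit (isUnit_of_dvd_one h)
  · intro n hn
    rw [hdeg] at hn
    rw [hcoeff n (by exact_mod_cast hn), Ideal.mem_span_singleton]
    exact (hmem n).neg_right
  · rw [hdeg]; decide
  · rw [Ideal.span_singleton_pow, Ideal.mem_span_singleton, hcoeff 0 (by decide), dvd_neg]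
    exact h0

/-- The leading coefficients of the given units, followed by those of `1` and `X`. -/
def leadRows (us : Fin 5 → UnitData) : Fin (5 + 2) → List ℤ :=
  Fin.append (fun i => (us i).lead) ![[1], [0, 1]]

theorem three_dvd_of_isUnit_aux {K : Type*} [Field K] [NumberField K] {x : K}
    (hfin : Module.finrank ℚ K = 11) (hr : r.length = 11) (hx : x ^ 11 = value x r)
    (hdvd : ∀ p : ℤ[X], aeval x p = 0 → definingPoly r ∣ p)
    (hext : ∀ φ ψ : K →+* ℂ, φ x = ψ x → φ = ψ)
    (hreal : ∀ s t : ℝ, s ^ 11 = value s r → t ^ 11 = value t r → s = t)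
    {us : Fin 5 → UnitData} (hus : ∀ i, (us i).check r = true) (hlen : ∀ i, (us i).lead.length ≤ 11)
    {W : Fin (5 + 2) → List ℤ}
    (hW : ∀ i j, (∑ n : Fin 11, (leadRows us i).getD n 0 * (W j).getD n 0 -
      if i = j then 1 else 0) % 3 = 0)
    {k : ℕ} (hk : 1 ≤ k) {s t : ℤ} {T : ℤ[X]}
    (hT : definingPoly r ∣ (1 + 3 ^ k * (C s + C t * X)) * T - 1) : 3 ∣ s ∧ 3 ∣ t := by
  choose e w hew he hw he' hw' hlead using fun i => UnitData.exists_unit hx (hus i)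
  by_contra hst
  have hroot : aeval x (definingPoly r) = 0 := by
    rw [definingPoly, map_sub, map_pow, aeval_X, hx, map_value, aeval_X, sub_self]
  set S := orderAtThree x
  set ξ : S := ⟨x, mem_orderAtThree_self x⟩
  have hint : IsIntegral ℤ x := isIntegral_of_pow_length_eq (by rw [hr, hx])
  have haeval : ∀ p : ℤ[X], ((aeval ξ p : S) : K) = aeval x p := fun p =>
    (aeval_algebraMap_apply K ξ p).symm
  have hintp : ∀ p : ℤ[X], IsIntegral ℤ ((aeval ξ p : S) : K) := fun p => by
    rw [haeval]
    exact adjoin_le_integralClosure hint (aeval_mem_adjoin_singleton ℤ x)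
  have hυ : (1 + 3 ^ k * (s + t * ξ) : S) = aeval ξ (1 + 3 ^ k * (C s + C t * X) : ℤ[X]) := by
    simp only [map_add, map_mul, map_pow, map_one, map_ofNat, aeval_X, eq_intCast,
      map_intCast]
  refine false_of_independent_units (ι := Fin 6) ?_ S
    (Fin.cons (1 + 3 ^ k * (s + t * ξ)) fun i => ⟨e i, he' i⟩ ^ (3 ^ 10 - 1))
    (Fin.cons (aeval ξ T) fun i => ⟨w i, hw' i⟩ ^ (3 ^ 10 - 1)) ?_ ?_ ?_ (Fin.cons k 1) ?_
    (Fin.cons (s + t * ξ) fun i => value ξ (us i).lead) ?_ ?_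
  · rw [rank_eq_five hfin x hext fun φ ψ => hreal _ _ ?_ ?_]
    · simp
    · rw [← map_pow, hx, map_value]
    · rw [← map_pow, hx, map_value]
  · refine Fin.cases ?_ fun i => ?_
    · obtain ⟨g, hg⟩ := hT
      simp only [Fin.cons_zero]
      rw [hυ, ← map_mul]
      apply Subtype.val_injective
      rw [haeval, ← sub_eq_zero, OneMemClass.coe_one, ← map_one (aeval (R := ℤ) x), ← map_sub, hg,
        map_mul,
        hroot, zero_mul]
    · simp only [Fin.cons_succ]
      rw [← mul_pow, show (⟨e i, he' i⟩ * ⟨w i, hw' i⟩ : S) = 1 from Subtype.val_injective (hew i),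
        one_pow]
  · refine Fin.cases ?_ fun i => ?_
    · simp only [Fin.cons_zero]
      rw [hυ]
      exact hintp _
    · exact (he i).pow _
  · refine Fin.cases (hintp _) fun i => ?_
    exact (hw i).pow _
  · exact Fin.cases hk fun i => le_rfl
  · refine Fin.cases ?_ fun i => ?_
    · simp [LeadTerm]
    · exact hlead i
  · intro c hc
    set c' : Fin (5 + 2) → ℤ := Fin.append (fun i => c i.succ) ![c 0 * s, c 0 * t] with hc'
    set q : ℤ[X] := ∑ i, C (c' i) * value X (leadRows us i) with hq
    have hqv : aeval ξ q = ∑ i, (c i : S) *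
        (Fin.cons (s + t * ξ) fun i => value ξ (us i).lead : Fin 6 → S) i := by
      rw [Fin.sum_univ_succ, hq, Fin.sum_univ_add, Fin.sum_univ_two, hc']
      simp only [leadRows, Fin.append_left, Fin.append_right, map_add, map_sum, map_mul,
        map_value, aeval_X, eq_intCast, map_intCast, Fin.cons_zero, Fin.cons_succ, Matrix.cons_val_zero,
        Matrix.cons_val_one, value_cons, value_nil]
      push_cast
      simp only [map_zero]
      ring
    rw [← hqv] at hc
    have hrows : ∀ i, (leadRows us i).length ≤ 11 := by
      refine Fin.addCases (fun i => ?_) (fun i => ?_)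
      · simpa [leadRows] using hlen i
      · rw [leadRows, Fin.append_right]
        fin_cases i <;> simp
    have hdeg : q.degree < (definingPoly r).degree := by
      rw [definingPoly_degree hr, ← mem_degreeLT, hq]
      refine sum_mem fun i _ => ?_
      rw [C_mul']
      exact Submodule.smul_mem _ _ (mem_degreeLT.mpr
        ((degree_value_X_lt _).trans_le (by exact_mod_cast hrows i)))
    have h7 := three_dvd_of_dual hW (c := c') fun n => by
      have := orderAtThree.dvd_coeff (definingPoly_monic hr) hdvd hdeg hc n
      simpa only [hq, finsetSum_coeff, coeff_C_mul, coeff_value_X] using this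
    have hc0 : 3 ∣ c 0 := by
      by_contra h
      have h8 := h7 (Fin.natAdd 5 0)
      have h9 := h7 (Fin.natAdd 5 1)
      rw [hc', Fin.append_right] at h8 h9
      exact hst ⟨(Int.prime_three.dvd_or_dvd h8).resolve_left h,
        (Int.prime_three.dvd_or_dvd h9).resolve_left h⟩
    exact Fin.cases hc0 fun i => by simpa [hc'] using h7 (Fin.castAdd 2 i)

theorem three_dvd_of_isUnit (hr : r.length = 11) {q : ℤ} (hq : Prime q)
    (hqr : allDvd q r = true) (hqr0 : ¬ q ^ 2 ∣ r.getD 0 0)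
    (hreal : ∀ s t : ℝ, s ^ 11 = value s r → t ^ 11 = value t r → s = t)
    {us : Fin 5 → UnitData} (hus : ∀ i, (us i).check r = true) (hlen : ∀ i, (us i).lead.length ≤ 11)
    {W : Fin (5 + 2) → List ℤ}
    (hW : ∀ i j, (∑ n : Fin 11, (leadRows us i).getD n 0 * (W j).getD n 0 -
      if i = j then 1 else 0) % 3 = 0)
    {k : ℕ} (hk : 1 ≤ k) {s t : ℤ} {T : ℤ[X]}
    (hT : definingPoly r ∣ (1 + 3 ^ k * (C s + C t * X)) * T - 1) : 3 ∣ s ∧ 3 ∣ t := by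
  have hmonic := definingPoly_monic hr
  have hinj : Function.Injective (algebraMap ℤ ℚ) := (algebraMap ℤ ℚ).injective_int
  set f : ℚ[X] := (definingPoly r).map (algebraMap ℤ ℚ) with hf
  have hirr : Irreducible f := (hmonic.irreducible_iff_irreducible_map_fraction_map (K := ℚ)).mp
    (definingPoly_irreducible hr hq hqr hqr0)
  have : Fact (Irreducible f) := ⟨hirr⟩
  have hf0 : f ≠ 0 := hirr.ne_zero
  have hfin : Module.finrank ℚ (AdjoinRoot f) = 11 := by
    rw [(AdjoinRoot.powerBasis hf0).finrank, AdjoinRoot.powerBasis_dim, hf, hmonic.natDegree_map]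
    exact natDegree_eq_of_degree_eq_some (definingPoly_degree hr)
  have : FiniteDimensional ℚ (AdjoinRoot f) := Module.finite_of_finrank_pos (by omega)
  have : CharZero (AdjoinRoot f) := algebraRat.charZero _
  have : NumberField (AdjoinRoot f) := { }
  have haeval : ∀ p : ℤ[X],
      aeval (AdjoinRoot.root f) p = AdjoinRoot.mk f (p.map (algebraMap ℤ ℚ)) :=
    fun p => by rw [← AdjoinRoot.aeval_eq, aeval_map_algebraMap]
  refine three_dvd_of_isUnit_aux (x := AdjoinRoot.root f) hfin hr ?_ ?_ ?_ hreal hus hlen hW hk hT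
  · have h := haeval (definingPoly r)
    rw [← hf, AdjoinRoot.mk_self, definingPoly, map_sub, map_pow, aeval_X, map_value, aeval_X] at h
    exact sub_eq_zero.mp h
  · intro p hp
    have hp' : AdjoinRoot.mk f (p.map (algebraMap ℤ ℚ)) = 0 := by
      rw [← haeval]
      convert hp <;> exact Subsingleton.elim _ _
    rw [AdjoinRoot.mk_eq_zero, hf] at hp'
    exact (map_dvd_map _ hinj hmonic).mp hp'
  · intro φ ψ h
    have : φ.toRatAlgHom = ψ.toRatAlgHom := AdjoinRoot.algHom_ext h
    exact RingHom.ext fun z => DFunLike.congr_fun this z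

end

/-! ### The binary form of degree eleven -/

section

variable {R S : Type*} [CommRing R] [CommRing S]

/-- The rational part of `(a + b * √d) ^ 11`. -/
def evenPart (d a b : R) : R :=
  a ^ 11 + 55 * a ^ 9 * d * b ^ 2 + 330 * a ^ 7 * d ^ 2 * b ^ 4 + 462 * a ^ 5 * d ^ 3 * b ^ 6 +
    165 * a ^ 3 * d ^ 4 * b ^ 8 + 11 * a * d ^ 5 * b ^ 10

/-- The coefficient of `b * √d` in `(a + b * √d) ^ 11`. -/
def oddPart (d a b : R) : R :=
  11 * a ^ 10 + 165 * a ^ 8 * d * b ^ 2 + 462 * a ^ 6 * d ^ 2 * b ^ 4 +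
    330 * a ^ 4 * d ^ 3 * b ^ 6 + 55 * a ^ 2 * d ^ 4 * b ^ 8 + d ^ 5 * b ^ 10

/-- Half of the coefficient of `√d` in `(y + 2 * √d) * (a + 2 * c * √d) ^ 11`. -/
def binomForm (d y a c : R) : R := evenPart (4 * d) a c + y * c * oddPart (4 * d) a c

theorem pow_eleven_eq {s d : R} (hs : s ^ 2 = d) (a b : R) :
    (a + b * s) ^ 11 = evenPart d a b + b * s * oddPart d a b := by
  subst hs
  rw [evenPart, oddPart]
  ring

theorem map_binomForm (φ : R →+* S) (d y a c : R) :
    φ (binomForm d y a c) = binomForm (φ d) (φ y) (φ a) (φ c) := by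
  simp only [binomForm, evenPart, oddPart, map_add, map_mul, map_pow, map_ofNat]

theorem sub_dvd_binomForm_sub (d y a b c : R) :
    a - b ∣ binomForm d y a c - binomForm d y b c := by
  have h := sub_dvd_eval_sub a b (binomForm (C d) (C y) X (C c))
  have heval : ∀ u, eval u (binomForm (C d) (C y) X (C c)) = binomForm d y u c := fun u => by
    rw [← coe_evalRingHom, map_binomForm]
    simp only [coe_evalRingHom, eval_C, eval_X]
  rwa [heval, heval] at h

theorem binomForm_mul (d y a c : R) : binomForm d y (a * c) c = c ^ 11 * binomForm d y a 1 := by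
  rw [binomForm, binomForm, evenPart, evenPart, oddPart, oddPart]
  ring

end

theorem binomForm_root_unique {d y s t : ℝ} (hd : 0 < d)
    (hs : binomForm d y (-(s + y)) 1 = 0) (ht : binomForm d y (-(t + y)) 1 = 0) : s = t := by
  have hsq := Real.sq_sqrt hd.le
  have h0 := Real.sqrt_pos.mpr hd
  set q := √d
  have hq : (2 * q) ^ 2 = 4 * d := by rw [mul_pow, hsq]; norm_num
  have hq' : (-(2 * q)) ^ 2 = 4 * d := by rw [neg_sq, hq]
  rw [binomForm] at hs ht
  have h := congr_arg₂ (· * ·) (pow_eleven_eq hq (-(s + y)) 1) (pow_eleven_eq hq' (-(t + y)) 1)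
  have h' := congr_arg₂ (· * ·) (pow_eleven_eq hq (-(t + y)) 1) (pow_eleven_eq hq' (-(s + y)) 1)
  simp only [← mul_pow] at h h'
  generalize evenPart (4 * d) (-(s + y)) 1 = e at *
  generalize oddPart (4 * d) (-(s + y)) 1 = o at *
  generalize evenPart (4 * d) (-(t + y)) 1 = e' at *
  generalize oddPart (4 * d) (-(t + y)) 1 = o' at *
  have hodd : Odd 11 := by decide
  have h1 := (hodd.strictMono_pow (R := ℝ)).injective (h.trans (Eq.trans (by
    rw [eq_neg_of_add_eq_zero_left hs, eq_neg_of_add_eq_zero_left ht]; ring) h'.symm))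
  have h2 : q * (s - t) = 0 := by linear_combination h1 / 4
  exact sub_eq_zero.mp ((mul_eq_zero.mp h2).resolve_left h0.ne')

/-- The data needed to treat the equation `binomForm d y a c = 1`. -/
structure FormData where
  d : ℕ
  y : ℤ
  r : List ℤ
  q : ℕ
  units : Fin 5 → UnitData
  dual : Fin (5 + 2) → List ℤ

/-- The verification of the data of a form. -/
structure FormData.Valid (D : FormData) : Prop where
  pos : 0 < D.d
  length_eq : D.r.length = 11
  prime : D.q.Prime
  eisenstein : allDvd D.q D.r = true
  not_dvd : ¬ (D.q : ℤ) ^ 2 ∣ D.r.getD 0 0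
  value_eq : value (X : ℤ[X]) D.r = X ^ 11 + binomForm (D.d : ℤ[X]) D.y (-(X + (D.y : ℤ[X]))) 1
  check : ∀ i, (D.units i).check D.r = true
  lead_length : ∀ i, (D.units i).lead.length ≤ 11
  dual_eq : ∀ i j, (∑ n : Fin 11, (leadRows D.units i).getD n 0 * (D.dual j).getD n 0 -
      if i = j then 1 else 0) % 3 = 0

theorem exists_eq_three_pow_mul {s t : ℤ} (hs : 3 ∣ s) (ht : 3 ∣ t) (h : ¬ (s = 0 ∧ t = 0)) :
    ∃ k, 1 ≤ k ∧ ∃ s' t', s = 3 ^ k * s' ∧ t = 3 ^ k * t' ∧ ¬ (3 ∣ s' ∧ 3 ∣ t') := by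
  have hg : gcd s t ≠ 0 := by rwa [Ne, gcd_eq_zero_iff]
  obtain ⟨g, hg, hg'⟩ := (Int.finiteMultiplicity_iff.mpr ⟨by decide, hg⟩ :
    FiniteMultiplicity (3 : ℤ) (gcd s t)).exists_eq_pow_mul_and_not_dvd
  set k := multiplicity 3 (gcd s t)
  obtain ⟨s', hs'⟩ : 3 ^ k ∣ s := (Dvd.intro _ hg.symm).trans (gcd_dvd_left s t)
  obtain ⟨t', ht'⟩ : 3 ^ k ∣ t := (Dvd.intro _ hg.symm).trans (gcd_dvd_right s t)
  refine ⟨k, ?_, s', t', hs', ht', fun h => hg' ?_⟩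
  · by_contra hk
    rw [Nat.lt_one_iff.mp (not_le.mp hk), pow_zero, one_mul] at hg
    exact hg' (hg ▸ dvd_gcd hs ht)
  · have h3 : (3 : ℤ) ^ k * 3 ∣ gcd s t := dvd_gcd (hs' ▸ mul_dvd_mul_left _ h.1)
      (ht' ▸ mul_dvd_mul_left _ h.2)
    rw [hg] at h3
    exact (mul_dvd_mul_iff_left (by positivity)).mp h3

theorem FormData.Valid.eq_one {D : FormData} (hD : D.Valid) {a c : ℤ}
    (h : binomForm (D.d : ℤ) D.y a c = 1) (ha : 3 ∣ a - 1) (hc : 3 ∣ c) : a = 1 ∧ c = 0 := by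
  by_contra hne
  obtain ⟨k, hk, s, t, hs, ht, hst⟩ := exists_eq_three_pow_mul (s := a + c * D.y - 1) (t := c)
    (by rw [add_sub_right_comm]; exact dvd_add ha (hc.mul_right _)) hc
    (fun ⟨h1, h2⟩ => hne ⟨by rw [h2] at h1; linarith, h2⟩)
  have hf : definingPoly D.r = -binomForm (D.d : ℤ[X]) D.y (-(X + (D.y : ℤ[X]))) 1 := by
    rw [definingPoly, hD.value_eq]; ring
  have hdvd := sub_dvd_binomForm_sub (D.d : ℤ[X]) D.y (C a) (-(X + (D.y : ℤ[X])) * C c) (C c)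
  rw [binomForm_mul, ← neg_neg (binomForm _ _ _ 1), ← hf] at hdvd
  have h1 := map_binomForm (C : ℤ →+* ℤ[X]) (D.d : ℤ) D.y a c
  rw [h, map_one] at h1
  simp only [map_natCast, eq_intCast] at h1
  simp only [eq_intCast] at hdvd
  rw [← h1] at hdvd
  obtain ⟨T, hT⟩ := hdvd
  refine hst (three_dvd_of_isUnit hD.length_eq (Nat.prime_iff_prime_int.mp hD.prime)
    hD.eisenstein hD.not_dvd ?_ hD.check hD.lead_length hD.dual_eq hk (T := T)
    ⟨(c : ℤ[X]) ^ 11, ?_⟩)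
  · intro s t hs ht
    have hpos : (0 : ℝ) < D.d := by exact_mod_cast hD.pos
    have hval : ∀ u : ℝ, value u D.r = u ^ 11 + binomForm (D.d : ℝ) D.y (-(u + D.y)) 1 :=
      fun u => by
        have := congr_arg (eval₂RingHom (Int.castRingHom ℝ) u) hD.value_eq
        rw [map_add, map_binomForm, map_value] at this
        simpa only [map_add, map_neg, map_pow, map_one, map_natCast, map_intCast, coe_eval₂RingHom,
          eval₂_X] using this
    rw [hval, left_eq_add] at hs ht
    exact binomForm_root_unique hpos hs ht
  · have h2 : (a : ℤ[X]) + c * D.y - 1 = 3 ^ k * (s : ℤ[X]) := by exact_mod_cast hs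
    have h3 : (c : ℤ[X]) = 3 ^ k * (t : ℤ[X]) := by exact_mod_cast ht
    simp only [eq_intCast]
    linear_combination -hT - T * h2 - T * X * h3

/-! ### The fields for the seven remaining primes -/

/-- The data for the prime 5. -/
def formFive : FormData where
  d := 5
  y := 5
  q := 11
  r := [3250156250, 3774409375, 1992375000, 631021875, 133237500, 19692750, 2079000, 156750, 8250,
    275, 0]
  units := ![
    ⟨[-612321500, -606028750, -268513500, -70755625, -12266525, -1464825, -121585, -6987, -251,
      -5, 1], 1024000, 4, [-1, -11, 2970, -69740, 335445, -575212, 332288, -60555, -990, 220,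
      -11], [2, 0, 0, 2, 2, 0, 2, 2, 2, 1, 2]⟩,
    ⟨[-139273001250, -164759841875, -83916146250, -24225240500, -4425940500, -545122050,
      -46350900, -2629780, -102730, -1763, 382], 20480000, 2, [1, -21351, 844965, -52578680,
      1480737390, -159084074127, 81144339177, -15342388490, 348247680, -3416490, -2574], [1, 0, 0,
      1, 2, 0, 0, 1, 0, 0, 0]⟩,
    ⟨[-3846515431053750, -3760235436735625, -1636362959101250, -422236608615500,
      -71795950412500, -8395721966150, -686427116300, -38375367020, -1410470550, -18838521,
      5285870], 40960000, 1, [-1, 384769, -115964676960, -3983990666810, -94511437356985,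
      -1591792061785057, -9470909953978682, -117990770280682860, -724719286153060, -6677763846710,
      4006519], [1, 2, 2, 0, 0, 0, 0, 0, 2, 0, 2]⟩,
    ⟨[374254841250, 345851868125, 146161193125, 37039709000, 6231440500, 726439050, 59194850,
      3330720, 118050, 1457, -447], 40960000, 1, [1, 568917514, 82694799118577580,
      -12407754447196491240, 468067715365841618555, -8471595910797237537, 102209170778598312,
      -658280040765105, 3017060012615, -7397620780, -172414], [1, 1, 1, 2, 1, 0, 2, 1, 2, 0, 2]⟩,
    ⟨[43668473116250, 131640467635625, 94696650440625, 32870981182000, 6859044471500,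
      938787666250, 85883622050, 5470026680, 191043410, 8662309, -910539], 40960000, 1, [1,
      20810394, 255692231612235, 1016865524651303690, 11849394448468143771160,
      -15767165502352559997781882, 7751387430180388570805037182, -123787502077073047829385,
      159523396893740935, -1019769424135, 1884806], [0, 1, 1, 0, 0, 2, 0, 2, 0, 2, 1]⟩]
  dual := ![
    [0, 0, 0, 1, 1, 0, 0, 0, 0, 0, 0],
    [0, 0, 0, 1, 0, 0, 2, 0, 0, 0, 0],
    [0, 0, 2, 2, 2, 2, 2, 0, 0, 0, 0],
    [0, 0, 0, 2, 2, 0, 2, 0, 0, 0, 0],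
    [0, 0, 0, 0, 0, 2, 0, 0, 0, 0, 0],
    [1, 0, 1, 2, 0, 1, 0, 0, 0, 0, 0],
    [0, 1, 2, 0, 0, 0, 0, 0, 0, 0, 0]]

set_option maxHeartbeats 800000 in
theorem formFive_valid : formFive.Valid where
  pos := by decide
  length_eq := rfl
  prime := by simp only [formFive]; norm_num
  eisenstein := by decide +kernel
  not_dvd := by decide +kernel
  value_eq := by
    simp only [formFive, value_cons, value_nil, binomForm, evenPart, oddPart]
    push_cast
    ring
  check := by decide +kernel
  lead_length := by decide +kernel
  dual_eq := by decide +kernel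

/-- The data for the prime 11. -/
def formEleven : FormData where
  d := 11
  y := 7
  q := 5
  r := [83600239870, 67452930655, 24738390600, 5443689075, 798590100, 82007310, 6015240, 315150,
    11550, 275, 0]
  units := ![
    ⟨[3058779410861485098, 2183840779842723407, 689660924769907175, 126843674014419452,
      15115541279395992, 1238082514187746, 70363650938426, 2715690083532, 71559014166, 1280397575,
      -267745273], 1919025152, 8, [-1, -5010739326703341, -45710436774420662860,
      -137478218926986213924450, 210506468230139161247391180, -105793856284583852309496396792,
      -3957127704217552080104371745427, -36221324733081116815680107125435,
      -920074720892076988076850, -45783999787569890, 448363069], [2, 1, 0, 0, 1, 0, 0, 0, 2, 1,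
      1]⟩,
    ⟨[7668319754458593717244, 4617076352783162562720, 1306756065183471182425,
      223657235133712967296, 25576824601601360732, 2025614986286587376, 112944972327163006,
      4317287299074400, 109316558372896, 1596283089936, -412512771023], 959512576, 7, [-1,
      -14749188531, -57843416165598430235, 6441558587246819892085845065,
      -3686412230897478538468260422848471985, -265792575411985979510197821587092919884357,
      -150199452642676885594012170680352393810382, -21271340987074859105809822491137507359860,
      -70100744373781614698107297152835, -93327404486935446584185, 597168151569], [1, 0, 1, 2, 1,
      1, 2, 1, 2, 0, 2]⟩,
    ⟨[-4911880695027054285642662, -3421685174759160723584433, -1028273051309635493083653,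
      -176477268130715131071428, -19564519980438836069112, -1502604385215630207518,
      -79575254404215560814, -2809614423278401780, -87963004226700330, 872319001238151,
      238219173989691], 1919025152, 8, [-1, -750207271, -215069136091855650,
      -3469084762689829128032990, -17450145922793900631332529531360,
      -994042760660578893317175200649252, -64493404309673824771117488536503217,
      -1444831041697286597827944818215150315, -20192761151650055669566871905002370190,
      -523745208248407682114980952220, -1102537717498811], [1, 1, 1, 1, 2, 1, 1, 0, 2, 2, 0]⟩,
    ⟨[6694898166001292901152652982, 4262124690982847001393779909, 1214840997738859996477889139,
      207576965234197838731274436, 23537436948055592008677312, 1842093442435597701188678,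
      101933945498809358181666, 3773309686861588394964, 103184409799174673506, 730807232429584733,
      -352784659501947757], 1919025152, 8, [1, 751105798729, 63844389356419611098992965,
      945547541319179700685201099134695, 5240948840103678364898683300787564984310,
      7920046101299934420739906960470012096118, 6200188298804988889533874353090906035353767,
      197788952567025754655443198184649784390305, 2705185604632877048958905416778915947595,
      -32872716639013318861366384861320755, -362593443478190969], [2, 1, 1, 2, 2, 2, 1, 0, 1, 2,
      0]⟩,
    ⟨[138690541980273931619872341678, 120383650713193471026091585761,
      45931314236670702078258449515, 10017570355380049436969444772, 1356965703439706002944514688,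
      116316998446219710114587774, 6322123153709054941482018, 242894239948142154717012,
      8387764833528892144234, -13092863884692353367, -22026883308981357349], 174456832, 7, [-1,
      3213645058978927199, -13440826363628365584964366329996630855,
      320688901433033550635052612413517107483769242775,
      -62015561176232814284753009275691744485705746219146294695565,
      -227236958907529553475141664295709402343366815628674281813473465178747,
      -77793848459984944230513187109294039419775303219028632362953086918588213852,
      -6704794152193572711799671527713114409839247397785266429459363227123452082596270,
      2723602634099435446486971169714875111290779300247381350672655,
      -51076337691851389298253752680580992561907305, -6809779205465249573791], [0, 0, 1, 1, 1, 1,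
      1, 0, 0, 2, 1]⟩]
  dual := ![
    [0, 0, 1, 2, 0, 1, 0, 0, 0, 1, 0],
    [0, 0, 0, 1, 0, 2, 0, 0, 0, 0, 0],
    [0, 0, 2, 1, 1, 1, 0, 0, 0, 2, 0],
    [0, 0, 2, 0, 0, 1, 0, 0, 0, 0, 0],
    [0, 0, 0, 1, 2, 2, 0, 0, 0, 1, 0],
    [1, 0, 1, 0, 2, 2, 0, 0, 0, 2, 0],
    [0, 1, 1, 0, 2, 0, 0, 0, 0, 0, 0]]

set_option maxHeartbeats 800000 in
theorem formEleven_valid : formEleven.Valid where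
  pos := by decide
  length_eq := rfl
  prime := by simp only [formEleven]; norm_num
  eisenstein := by decide +kernel
  not_dvd := by decide +kernel
  value_eq := by
    simp only [formEleven, value_cons, value_nil, binomForm, evenPart, oddPart]
    push_cast
    ring
  check := by decide +kernel
  lead_length := by decide +kernel
  dual_eq := by decide +kernel

/-- The data for the prime 19. -/
def formNineteen : FormData where
  d := 19
  y := 9
  q := 5
  r := [874239942690, 542767189855, 153170047800, 25934946675, 2927558700, 231325710, 13056120,
    526350, 14850, 275, 0]
  units := ![
    ⟨[1042740500755066, 505973273765077, 109724187626937, 14308794357216, 1240658420568,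
      74177946778, 3161285270, 87755416, 1993350, 13977, -6439], 2135179264, 7, [-1,
      -1451548525911, 40852757461087165, -349941161361641404335, 615289176524151927935005,
      -621185305473767444276559297, -190920941485117078069637, -29714182872624646715,
      -1539848239324890, -31878213070, -263791], [2, 2, 1, 0, 2, 0, 1, 1, 2, 0, 2]⟩,
    ⟨[-345797847175694861378, -140904728684874025797, -25584838839216268503,
      -2817584520049172340, -203415866032905736, -9985842685420118, -357259369328410,
      -5383090223652, -380274002894, 23305291059, 151643145], 17081434112, 2, [1, 4636782029,
      45867390556129432180, 734075518939178439496990, 3078549569339378793322228180,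
      -25738153980634187218032872262, 2869283265192673758719468085237,
      -12858576438917209115795723725, 1864048916699091476103768260, -7786628508192089820,
      4111036391], [2, 0, 0, 2, 2, 2, 2, 0, 1, 1, 0]⟩,
    ⟨[-505988707271626017008078, -272473251959127143079255, -60622953046319100530143,
      -6408774123056138025532, -110037932152794509008, 59212857264223490350, 8504907348685507654,
      584475286097392500, 19637124013595430, -50872562212367, -27884583440367], 17081434112, 2,
      [1, 250935724590371689, 2446680516927623727858616082188064175,
      -481319158460725426224276020022981889368212279335,
      172873097310940416447430858228412173526023795391379762917705,
      -8245361551737737499527524107100698442642065452156958184337,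
      133579358295900748528111432360652205893217038064284453662,
      -652733405786406898182932387041054325019838225448307100,
      -52181433414757209325463456446361862876033965, -9862492709892568861083007507158405,
      -195135920750836989], [0, 0, 0, 0, 0, 2, 0, 2, 2, 0, 1]⟩,
    ⟨[24476758391715720652429271813153670192662, 11580825673662663861262682515353181500375,
      2560538604270236848900270857031361620093, 341755391479452265791041022433558268764,
      30398105543571399970971976710449945688, 1872681149462253786818207716126096914,
      80821780652529284100151172545350878, 2427488154577022255769994587399980,
      43665853286679268909986712248090, 1123982757505326254993743041935,
      -182126337857381934688772925667], 17081434112, 2, [1, 2176672634826290659523289,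
      1373254498908270040066761143794667252462905598020,
      -67772654072214288931185127014181199713402327655324564982390,
      310909369222198078327979160171624846420813091009116915912550321655,
      -11590726915906571669239190484268955546423856376370159121478941976416144477,
      4458895487345867186427126309007050554315568185043034147297658238361370187,
      -645862554363000087582363191281047306621484597929719452220539048967463095095,
      1841964199574972761182224383452176028485204615905035943897081540815,
      -2460478598950176572444450142064158010081581895282872714255, 84095798593964680960502089651],
      [0, 2, 2, 1, 0, 1, 0, 1, 0, 0, 2]⟩,
    ⟨[-34968457885635654436105402426955961976673789564,
      -9887122123245338371838445610540814691094264992,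
      -44241260085460168631938208387138948905959769,
      296304702815070201775173317149584379619130032, 48111393450099888921828147706516364549310468,
      3979904864396168086402456731614038763024768, 222163869409527414817632277165181582347138,
      7156568637466209382223896772397430710448, 103814516777342436285033054198905731392,
      12427095607505672112315808927191177280, -710075120457350128281761701761490289], 8540717056,
      4, [1, -1141781019226076660656952951140326531,
      518261362126866053209867397056478440472275566081725911908099870866843660,
      1192835692733660406337109591517055668738890511195463222041394440898205816793595824097048735340563799987480,
      869559309513089892021761435320179260479945042955241847328916688542320958226161908031916739130068825990791750503761709279359639162732299720,
      2602511879725723601294474009053326952195883382113554034696509059796334205269134858312765257062068520631231041292981728827357653317160470721578,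
      2203787390880814561817729680639215234990596287239732070300448423821730046876706454405852948921930638937842678315756173685447468604139412738385487,
      -1863195423932374469074423109036900645878872116791628997204798265675099868038437913981135935834681358106969078064611093954088081930752550526815,
      446567333775112191431100012344494412539099069765345663445527599754778636575607312352168899283616926485848320,
      -27848884351360334288394795822796123279277324797951755592887781276682502740,
      4410143628295601780290296640647851221], [0, 2, 1, 2, 2, 1, 0, 0, 2, 0, 0]⟩]
  dual := ![
    [0, 0, 2, 2, 2, 2, 0, 1, 0, 0, 0],
    [0, 0, 1, 1, 2, 2, 0, 1, 0, 0, 0],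
    [0, 0, 0, 1, 2, 0, 0, 2, 0, 0, 0],
    [0, 0, 1, 2, 0, 1, 0, 2, 0, 0, 0],
    [0, 0, 0, 0, 1, 2, 0, 1, 0, 0, 0],
    [1, 0, 0, 0, 1, 1, 0, 2, 0, 0, 0],
    [0, 1, 0, 1, 0, 2, 0, 1, 0, 0, 0]]

set_option maxHeartbeats 800000 in
theorem formNineteen_valid : formNineteen.Valid where
  pos := by decide
  length_eq := rfl
  prime := by simp only [formNineteen]; norm_num
  eisenstein := by decide +kernel
  not_dvd := by decide +kernel
  value_eq := by
    simp only [formNineteen, value_cons, value_nil, binomForm, evenPart, oddPart]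
    push_cast
    ring
  check := by decide +kernel
  lead_length := by decide +kernel
  dual_eq := by decide +kernel

/-- The data for the prime 29. -/
def formTwentyNine : FormData where
  d := 29
  y := 11
  q := 5
  r := [5550870039110, 2804715018655, 644159980200, 88766682675, 8154831300, 524418510, 24088680,
    790350, 18150, 275, 0]
  units := ![
    ⟨[-401892626152360938, -106670986592510779, -11665068250596383, -769473170954332,
      -28606382302280, -179898022970, 7831085030, 2112996276, -55875238, 7006749, -155375],
      92704735232, 8, [1, -13066996549596, 47186815399421607103148075,
      -116340788105383798307201260409285, 496227405233751379509163566912430,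
      -604761680335446433172147142870502, 26967768452419310655453015262,
      -1618819984866089096039630, 3227630871140695855, -4039013120065, 2468026], [0, 0, 0, 0, 2,
      2, 1, 2, 0, 0, 2]⟩,
    ⟨[7214413994399696874278546, 2107306273113364409046515, 261774153826871695005809,
      18790070843572766901660, 750211108168614116064, 11876089918819408714, -146107604243384170,
      -45730137065979892, 1676815233112662, -181304468826085, 3699920624177], 185409470464, 4,
      [-1, 489952419, -154438427429280885, 33602373583657423527565,
      -734860526350840906828435903675, 1008935733941629601693041257931503,
      -6223710834340251996416322176734336657, -1857458688610113666638388497116535,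
      -7429137271873291145685633460, -60909243618569576526946650, -9072672260421], [0, 0, 0, 0, 2,
      0, 0, 0, 1, 1, 0]⟩,
    ⟨[-32715807258477934454, -16748479662814226347, -3756765179456935020, -477193559177909120,
      -36903184565895536, -1743398836875710, -51147233814652, -1324580855192, -36689748922,
      871726849, 58215944], 46352367616, 7, [1, -85527273605576, 72793494485751160,
      -37026868520544817640, 598563446448530824690, -9070942278164465090777,
      -10794690090782903005338, -5977563102865360328575, 1019647823223520182945,
      -45591481401122150615, -6991611154], [1, 2, 2, 2, 2, 2, 1, 1, 0, 0, 0]⟩,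
    ⟨[-1960490682366974079810595408102, -681844542862433589505604528125,
      -115199067446076691783289792137, -11812355634708165617260391508,
      -820271427497136989282919752, -39203642536783084908099366, -1356352002157395260443238,
      -29969086131244050054916, -572863122323199865338, -3614168214688435077,
      1797488414163073815], 92704735232, 8, [-1, -11716991, -37341063197405, -3895731056999181125,
      -152406966885650162320195, -2492599404862572432538071587, 2391268999005375173554806890833,
      -654719123717427503914259092818355, 48609960682704914148654576608929250,
      -3821008026059119159904636936708324820, -3905049959953223961], [0, 0, 0, 1, 0, 1, 0, 1, 0,
      1, 0]⟩,
    ⟨[-51180416156630264066, -22884994135462892547, -5005392091985554173, -693705946124958188,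
      -64946498146533536, -4158735654614074, -172196527602606, -3358775432444, 45239746170,
      5242414629, -417581], 185409470464, 4, [1, 85526269055730384299,
      2287096999919915011962455528407976287205, -1751925764664041567588434131946549553693725,
      696098807193786251128742593681505205582789655, -5060158245796635369546441861694555042142187,
      35110318059973342103009942093653380917462, -53153196513220493385348732614425591250,
      1986157791423304896436799373515, -91361591296815477782045, -347320353699], [2, 2, 1, 1, 1,
      0, 1, 1, 0, 0, 2]⟩]
  dual := ![
    [0, 0, 2, 2, 0, 1, 2, 0, 0, 0, 0],
    [0, 0, 2, 1, 2, 2, 1, 0, 0, 0, 0],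
    [0, 0, 0, 2, 0, 1, 1, 0, 0, 0, 0],
    [0, 0, 2, 1, 0, 0, 0, 0, 0, 0, 0],
    [0, 0, 1, 2, 0, 1, 1, 0, 0, 0, 0],
    [1, 0, 1, 0, 0, 0, 0, 0, 0, 0, 0],
    [0, 1, 1, 1, 0, 2, 2, 0, 0, 0, 0]]

set_option maxHeartbeats 800000 in
theorem formTwentyNine_valid : formTwentyNine.Valid where
  pos := by decide
  length_eq := rfl
  prime := by simp only [formTwentyNine]; norm_num
  eisenstein := by decide +kernel
  not_dvd := by decide +kernel
  value_eq := by
    simp only [formTwentyNine, value_cons, value_nil, binomForm, evenPart, oddPart]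
    push_cast
    ring
  check := by decide +kernel
  lead_length := by decide +kernel
  dual_eq := by decide +kernel

/-- The data for the prime 41. -/
def formFortyOne : FormData where
  d := 41
  y := 13
  q := 5
  r := [25572125677930, 10900204372255, 2111931221400, 245513937075, 19027479900, 1032248910,
    39999960, 1107150, 21450, 275, 0]
  units := ![
    ⟨[-52275793130756571034, -15041243165155743265, -1797872935475732713, -118497595687285956,
      -4675341356223680, -132613838410142, -4995420843414, -55614152116, 1069158994, 5016375,
      2733959], 740756291584, 7, [-1, 59804514, -4508663887825350, -23206001058645502350,
      7438634461989973377520, -40572061815777944500712422, -14607886545898695016029377612,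
      -4421952172259374903692358878875, 944039432221486419195850, -59513460296526555, 51233204],
      [1, 0, 2, 1, 0, 2, 1, 1, 2, 1, 0]⟩,
    ⟨[631324428297796269314, 196315631231955460345, 29091018443002175715, 2609969375139756948,
      157158357921190264, 6542064456529502, 192831968023202, 3889247762148, 46970021246,
      1426369073, -199250813], 185189072896, 1, [-1, 19295652636739864,
      -155994108260887032666665197745375, -1989268003773637412180317803152010219675,
      1085327597470326005633332817413656375085, -502700317474921434255592832428963315407,
      -1987033932940522544737438666399062, -3118651368374321022538809800,
      -17031109156906544069150, -44812884226537790, 410802194], [2, 0, 1, 0, 2, 2, 1, 0, 2, 0, 2]⟩,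
    ⟨[72547706773974564614514061154, 20866352856691222596518167109,
      2945462740794967739911779205, 252186452890415085305714468, 14696543948057321639423152,
      586489630946741134872422, 17204609636580889583630, 307181297584870093940,
      5612179545215089558, 21589171589998013, -15881500239851067], 740756291584, 7, [1, -58487726,
      23906143463942300, 9135605054984754239410, 2313578227509643381721874275,
      103457167371274809593568177809853, 1472603617357628187548296348722519482,
      1459933270556984703395833061625584523365, 435999394738718541732117166133660658750680,
      -119590656217925170206290052823000, 21790331478105641], [0, 0, 0, 2, 2, 0, 0, 2, 0, 2, 1]⟩,
    ⟨[-14241081385269286853346, -6269971910546189306697, -1262798774327222882971,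
      -154362388890831266528, -12854290703483962356, -779922105918618458, -36206901196643998,
      -1331860459458696, -39458993165458, -970625609461, -22033216095], 185189072896, 1, [-1,
      1142759027399, -37653475272390746671291950, 4441127562928535850399431610845,
      -205506141956971410864680731467658980, -7175189131341428109743477680355800247,
      -77437552163898374690809519610484685562, -193915609659112312748673423790988105150,
      -229069009969013777868321696292602279675, -4139926215914906256758477515,
      -18804866841432991], [2, 2, 0, 0, 2, 2, 1, 0, 0, 2, 0]⟩,
    ⟨[1585422120498637643843666382, 674674796790208642380768063, 121367139532818981717942653,
      12132081065611366063780356, 761021815540807427185232, 32924765707166874322346,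
      999388543323404763206, 17855945818976109796, 353717591515791946, 6132209515984943,
      -1017323172452395], 370378145792, 5, [1, -11189329905918319151601,
      42052477221220475990791336369565275237813305,
      15751514775101752583820610106169709914125298282398250,
      3385215365521353596364560653511109891740633915228105567849575,
      -7581408246677081105694426482262761144233400160881850388588723372,
      2944815345620750009516391342287104796752659133961593584007,
      -436232020323882742715500759666009715545796532260325,
      -478607638971742752481927477953269611515, -7427931515884853687209808946590,
      5154671198948986], [1, 0, 2, 2, 0, 0, 1, 2, 2, 2, 0]⟩]
  dual := ![
    [0, 0, 1, 1, 2, 1, 0, 0, 1, 0, 0],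
    [0, 0, 2, 0, 0, 0, 0, 0, 1, 0, 0],
    [0, 0, 1, 1, 1, 2, 0, 0, 1, 0, 0],
    [0, 0, 0, 2, 1, 1, 0, 0, 1, 0, 0],
    [0, 0, 0, 2, 1, 2, 0, 0, 0, 0, 0],
    [1, 0, 1, 2, 1, 1, 0, 0, 1, 0, 0],
    [0, 1, 0, 2, 1, 1, 0, 0, 1, 0, 0]]

set_option maxHeartbeats 800000 in
theorem formFortyOne_valid : formFortyOne.Valid where
  pos := by decide
  length_eq := rfl
  prime := by simp only [formFortyOne]; norm_num
  eisenstein := by decide +kernel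
  not_dvd := by decide +kernel
  value_eq := by
    simp only [formFortyOne, value_cons, value_nil, binomForm, evenPart, oddPart]
    push_cast
    ring
  check := by decide +kernel
  lead_length := by decide +kernel
  dual_eq := by decide +kernel

/-- The data for the prime 71. -/
def formSeventyOne : FormData where
  d := 71
  y := 17
  q := 5
  r := [293199071022770, 95272398757855, 14071776516600, 1247044665075, 73675625100, 3046938510,
    90006840, 1899150, 28050, 275, 0]
  units := ![
    ⟨[-722928974802566836701854170042085813141036677225077731686095914446731842,
      -190685274978744446894216463937023947633636387831387955492159167754437861,
      -22089751448126444877936987297772124215834100724904969308236327684205491,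
      -1532683729097670363826798560952015100318603395169310609505446056458804,
      -70792535543341238969569149811218501259133785928550895809124847085848,
      -2231632924445003957610264672767841055868966970932131940845416281046,
      -51309643103841784850912560817877308477319874160034883290367661442,
      -721896822229495381880555541754631465422627674940460972012899172,
      -8421973083357499311936229620575804389473358341223616440625758,
      -236135967232433094149924832679982520459210324622146626167213,
      29894510084244882212511923137969119852223807158242660568813], 3330759852032, 2, [-1,
      265423242455982019720767462838194167598664731399,
      -1196420476599551368758994379250233078034885937009531177366488406389095294933119298074940230381555,
      4973407913455122607527999573136780493199621589300578080118433936360413699006487581037929636648834021200301303229000525,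
      -304153907417501138768615268089321763702549625589477691504440573129537947654583772652909303213770820598680162352466876300459636277169012915455,
      -2337938970606967453255825888517762084037400253113537216392703695609278094063255873228560700812207626247372473156970831745110144959791355030113307057787,
      -6583464830644888895329928885948143786241253679906051683592096096423594327536700619297845125864564777411617042406551554557436489712861429362333209851506522933852,
      -2613352526959857381541134863508523256622410481031661289005483843999572625891774431727017497244053453196759052227749715172094148601318944295795077400,
      -1033971446160887577829361832589653047598360821964408242428060347577572154815306070952936051373026084996595252717884670988524409670874165,
      -565599293030673339953492762010228037903476648716342259571616655542078736592561419325760912798067799742413902427226425,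
      47514411915680115625113383028234391004017697855897854997799], [1, 2, 1, 1, 2, 1, 2, 2, 2, 0,
      1]⟩,
    ⟨[305409608186798898798524238675818637865670511168582264960110676353263070846,
      67989356055114424858871137662258671177359137373384086688793326255133624395,
      5694433698556249045584234675359220754666190232899631829901000822733118501,
      211722143580113656223009782750027209854874769087009779715715355108152684,
      3104947411209912896038833363846833037349030451584460024260109189035720,
      -35033633924792700618840302698970267627125166173912069956705809580438,
      -6509682713159677198029128443837667330280904695853170603515165865714,
      -123060830692061391543002249871609614785212348796509344007900420484,
      4697189348384288587576138632806612685986467323929321094273172418,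
      -456963966668181133367579906815135385207310476509844375511753373,
      8314584613274880742914736084946369948788094311986916246483397], 1665379926016, 4, [1,
      31912865062263687277733711020710595341678108551668476308682972341769,
      30682511478364050599883352676763452331205781486569621960507134647241187760429011359776165182768416304238784099666982955512098519811732155,
      -25814660986528423910571352459160795457425456744927889668979110159842533449224429501057713474485209579444567802716156129816060977405128612611293166646072676283385455,
      2159139104999460178855929474485791072661717717880509716133785236077104860939501507956646304148371199305201344646669250725283007155923344163429392574118946962517358630,
      -249170597654524681717665256426533382578557922039431847523647710371217323870176543174623168057111251997775102824627800708268094359770750628076334360619667553561034977752,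
      1055817642877092703572662225531761558336176468763477241191982170788948770226186884690262646767678702555686880415377791187916679006061669707173634359953759305950218796807,
      -2930800030237760641158716345740926807914173031777896636096631432908962487086096560313693930051765388188838285894347930749878960831544064351940890986467401288836093325205,
      575824740768901242095722371827253757299322414349163556947781042749588866229056988953428058321171913884364341090452464819881824586651758837092831905,
      -34715526430212217878542565284387703434552455812362162472859357960506985545357545061334896958783605739133403378432693769698605,
      -203045553133760550407749633762663770576371489002199620386198849], [2, 0, 2, 1, 0, 1, 1, 2,
      0, 1, 1]⟩,
    ⟨[-213577249377437310435018761918705509866195743248602461682601412375466924984,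
      -70472442520746630139990105511943902401583149102812716393601904353130932442,
      -10142214036435161622154179086687212539009980501931439622234735612036848809,
      -818183056216703726330204615847654929991481726592686213650243545392759168,
      -39293500469858400034456507594320253379941484693437932137008527415650492,
      -1099714252633097981475128777991542341741084296507854298379200107596788,
      -18357702788819193901165109261457965820743236554792572189657807748678,
      -388745369428523501706121494720265100021888566179769636714961094000,
      -9306272864370564074534854986670970728853633054463613495274916740,
      273440721262080483685434029289199832188462625804729158721426750,
      8749961396016386850576262290981987252219198527287447015915879], 1665379926016, 4, [1,
      -82999353446032052433137973691512874797788412826179696808938674381,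
      138338584826543640372099204765743459516252391522956812917357520504327587869709393965625014911316057046514518339447051526422663934510,
      -2233491079270860297881685957557382531468924031426387596436142310555679301077793907771158572373807239399721045714835106244181089435340397264645778969788095194840590,
      12837497786655579008797627871522326005178684754938478880927720174843399103548602103278947227645807240641070638579011394663773160173710697565877809100962499726725471138715043350344340783237404585,
      -247669714938827870488522499249997444213998173486663404539713464297616146812535710290912562505671195368510694147316882509538273337192490837270593312387977227444260826954892776995682417847,
      -175114572909693269718607041508106219520086689470304014392676610704186387559622607472041791884430717903385344253549472296680042764337814757139451376079071353864295468215468998,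
      -77830449474461589584442072877253188455679698932417338434862178321269741871821054035879521962683728736665926793636124333607540746944477765088300988698957533253930,
      711377032304671937823137268583346640149034387239299398726213246569402665185567347277287709274446971715345026937524474248029899072932093364472910,
      -2140255603638542357441949846360898443093242268143480909709651626801677308417065753692252884589814149385666155335543135269956600,
      -2648075858521562152795488301776829781780815792687126314571154219], [0, 0, 0, 2, 2, 2, 2, 1,
      1, 2, 2]⟩,
    ⟨[655299009776864370031398041784986508544370886402869878927232116651325243675665602,
      225391020634832141005422339955830852474704901733492118210514043052955357139331749,
      35735153582121544249079809033592655816218670648726120649631420665079713867581395,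
      3466481053505005913799336065663642920745440636211572056778120502865270953536004,
      230564037276017715266202086574339417989305695206517650607004512498897093975400,
      11193016199226634332129179517271383302926828880688101736835702583709951754470,
      413948894471990964964412178726039778494931257255182237731117836188794925522,
      12113934772503651405910220471049048994453418220352854675341761829439821268,
      292982594840628417595385906581814507233604937555211024516603238299813582,
      6184344978664719695928444590066833612782126475276679438493979318980765,
      117566967084717527080504259655148688281270527407895895052125261767011], 3330759852032, 2,
      [1, -53484254975116892354196529350776020905020720231,
      1960211640620530171967233371329403816890212955968599634556310992714259872275695645594691010440,
      -13354672070222019480875196158682174798370602887869525924799939770987844985144236142468001699157238384193614805647848242589980,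
      22880942191937180458851829242354778286314580462340208746778935127018708511150654132220156501758689600222593285862662696595673493500751728347067426987142830,
      -16654741799237018494415406693853074179619711095045192293417385153446588163532324812134146994309791705360513954413988658864130060069482356669949216365801120872,
      3421960452697699939383402914459743219572314623583722549387825765221358414991011917912059182174923727341732740706902070486294469278395994506484156356229420544427,
      -1269965692092159782082538530465033229405625608462390522409757824683945582606387622294408326608219348806302562247613975556451775439819342980190565992486390045,
      213558730605975623334934051150319387362271578155190418650460715954670981857358933712440321437480883832108210424681215070976288921101906456415788678093260,
      -139712324952039921030450196516595975527645256460884337731611842426942103265139488777759474282392837010208890537400,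
      25362595190105567375198498869005815295109156892809070502418047055718652231], [2, 2, 2, 2, 1,
      2, 2, 0, 2, 1, 2]⟩,
    ⟨[-4160927441107646364739676482996295202806099863383182397503600888452926245247146,
      -755380918139081235133685524864670202488046098332291487354976894060320605044073,
      10906933915208061049780014498070161801701115833964397760072628617037019711985,
      16258396551561826089229700678158923278747548763422860589812272530446692822236,
      2241231258834021863619903081222991301684810994026840525978723951865336849672,
      166743331581349218240144374657537524825589690373954461838947835865865498514,
      7774096452190507763019371229296276253893712376980933463450850329940635606,
      221567755408798697119710517537489457565091504462412167616107745988979628,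
      2638742844650691944630807093165979635987561932556189958856304311380746,
      -60745732530840885453688592722232182521746124578422413320841781681841,
      -2870712520604349329474134090484590497271034436973210392423209237807], 1665379926016, 4,
      [-1, -50484363367753529964058613039109425468250487336354273233595251761,
      -54673216363538458904093102258163849881444478701359047540079562007977946858325934721077035436081400152098741507014254508995,
      -14824461108421786260970335844659593782577416417532428191869782067087825615297610683804216781753910668210461743519424980538156080097609408213306994451608166275607891327283263059735,
      -579527337680574917001449617369330076551404235438988449655725487865588546281349248812264309385301064126058484338408451869249223068629607181020426802592759638595901800326950309260874003881584402148749115915,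
      -85521931918719637624587232355411558933586338015874013059007175035991249112656713351933309302702519788506863741164942203716253728936542269738557377914211874597079496532631084726268194747326216686086161895179269039284266873240033267,
      -22715174146617688626899253391289969677577007435857635412905003467093130588733288694482330839965425143072263223233277395167673693048153628866404449862196796820995162206075253372383313040152713314288331777128173818595275099078225122995252451979104646367,
      -3650793379016478357686690693677563858799322182749892513777602494284808953519050332207625517610358569300179418551531178415034226402136704390447190959194595192937285412649795057516642771200632533313297981119382904350412499386674120087253287270429833450325533351207283689315,
      58033495130266904628585167683367434737238396778337052385311559067849025379722656291921509305679718402048834506097635138283363845586986224175480862611926182495793968056515045551366300530074307433526928451310,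
      -248323640563848900266607442202901887059252774292682992630621347424738831335977425722274884775086663492288803488640715453940318786868245324930,
      4813754833428095895033378714647992336085611297221378347857940953637819], [0, 2, 0, 1, 1, 0,
      0, 0, 1, 2, 1]⟩]
  dual := ![
    [0, 0, 0, 0, 0, 2, 1, 0, 0, 0, 0],
    [0, 0, 2, 0, 0, 0, 1, 1, 0, 0, 0],
    [0, 0, 2, 0, 0, 2, 2, 2, 0, 0, 0],
    [0, 0, 0, 0, 0, 2, 0, 2, 0, 0, 0],
    [0, 0, 0, 1, 0, 2, 0, 0, 0, 0, 0],
    [1, 0, 2, 0, 0, 0, 0, 0, 0, 0, 0],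
    [0, 1, 0, 1, 0, 0, 1, 2, 0, 0, 0]]

set_option maxHeartbeats 800000 in
theorem formSeventyOne_valid : formSeventyOne.Valid where
  pos := by decide
  length_eq := rfl
  prime := by simp only [formSeventyOne]; norm_num
  eisenstein := by decide +kernel
  not_dvd := by decide +kernel
  value_eq := by
    simp only [formSeventyOne, value_cons, value_nil, binomForm, evenPart, oddPart]
    push_cast
    ring
  check := by decide +kernel
  lead_length := by decide +kernel
  dual_eq := by decide +kernel

/-- The data for the prime 89. -/
def formEightyNine : FormData where
  d := 89
  y := 19
  q := 5
  r := [803404696805590, 233375421767455, 30814362301800, 2441195178675, 128931953700, 4766687310,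
    125876520, 2374350, 31350, 275, 0]
  units := ![
    ⟨[11416692651394339439200534, 1874721557793155686136627, 161234648786935979690668,
      8197632787008252143088, 298126225529100553104, 6704810287719380190, 147087990014386364,
      133956663321832, 73314247719354, -2059468745065, -31110785096], 4111875506176, 4, [-1,
      -113712993801, -3267958249391010181160, -12779850194051350976915195,
      3904858779327084032757221600, -1158029043725840886493534494832,
      9544324864985135053008431451563, -19977174288766277548801064881135,
      6475480234279901764903715270, -526233435171734930301695, 1388596248589], [1, 2, 2, 0, 1, 2,
      0, 2, 2, 2, 1]⟩,
    ⟨[-13517790680989762001201978586, -3982318353621493386737921687,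
      -490744522721072926373842373, -33183871273427381117005980, -1397619409196380083177136,
      -41195069321826772541362, -857274999212080682782, -9082693635961032620, -173166632717824798,
      -3097407475184751, 395544488769675], 16447502024704, 1, [1, -22179185517609706806,
      201671208817813731327569076297406602930,
      12445802503384028772026488536592445679241798508699910,
      1381402266909855929939095698641241791733961925090881003915554991865,
      -720877924686694922025599897262269220934922671406034646417724272,
      1700489991432449916966042724136782126853879055206833579432482,
      -197882986849733137999380154986309542303749386783656295,
      51062427260922625272778056089379369543390, -475764322560087166541700437255,
      -1154427816876829], [1, 0, 2, 1, 2, 0, 2, 1, 0, 2, 1]⟩,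
    ⟨[-15820038615839304831194273640562, -4978311096683030402244528515271,
      -715244083845975058045724348279, -61633760230397789005347210732,
      -3497777597158006322026627800, -133188137769264695238306178, -3171208791256654760397834,
      -29343090525074009985244, 821433182407678737906, 30843131615933871377, 77978822604332249],
      8223751012352, 2, [-1, -870668307141996, 112443439560959724372788043895,
      -8557527988048462443859769553164892524976065,
      29949248582435658355355828461625418438795125359162725,
      -61198073065372732460535061421436169944460060884311392270272332,
      -16753883249208682535933681535741318924543812928159290212163232372,
      -1195643658035305865438587689489076739329330557099865432731121132040,
      3354097247322134116723644308031161704664427955511973025,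
      -4712815932484537807996221119677518587470425, -4341776052979811578011], [0, 2, 0, 0, 1, 1,
      0, 1, 2, 1, 0]⟩,
    ⟨[-60504978893765088763685343983286, -18669799328693545133711217485407,
      -2657772891909393481561201536362, -231745151209421681514680455048,
      -13876169238568037639114865888, -607787381583125373559820718, -20353844032599747254369880,
      -542624853788159590509520, -12063670876862785057530, -236340032698244364571,
      -4213123994233084462], 4111875506176, 4, [-1, -5155565817727838471780866,
      -48794539562256584860629767250730038676694657991625,
      1339885944527137816829056896704926520870819395476083285,
      -12941932957041463531509848319654435721538445587811077631745,
      -246318117450082022558233860427594986000460640737991119295807,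
      -2040985739720755394088608772497748504146160757306570761322792,
      -848072905285621282087732712480503913647305437979172480876895,
      -829598153212371674637926892938881680068645157963211381379145,
      612124792994499948784109082593192445973325, -1406158741514865998835571], [2, 2, 0, 1, 2, 1,
      2, 2, 1, 1, 0]⟩,
    ⟨[27552880591903747918428607842478, -622716685606341105612996611739,
      -1352476945140943421459147924649, -206143014182142640475009151564,
      -14702148745191149605208582640, -556018317137057001115505098, -10128604239153593059735318,
      -92488819067279989995868, -4447010924091897974918, -79577600083399679731,
      6027123474112815751], 8223751012352, 2, [-1, -20525194513309501542366719547732636,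
      -126237696595743976051135035964125234012507063567044929846416920114440,
      -7613142257565161226754236314813601111520564052504477945758107778492269972878346941714240,
      16040364100063943150749048103833195096892345125341140266570769106687261776018035248921814136905,
      -9830399735160625166417021918902411406629314496379590029172001288909693497615237942415472636029397832,
      -234204878597063885289525824083117993712267394009172175713275726107496657841628475422422,
      -1706458927036033128818346554660380109306197152211045339785371121209800120,
      -266923837225933900612377469417879619833563254529184826475,
      -82489480623422118605335012704164183452920, 66944182354449411814], [0, 2, 2, 2, 2, 2, 1, 2,
      1, 2, 0]⟩]
  dual := ![
    [0, 0, 1, 2, 1, 2, 0, 0, 0, 0, 0],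
    [0, 0, 1, 2, 2, 2, 0, 2, 0, 0, 0],
    [0, 0, 2, 0, 0, 2, 0, 2, 0, 0, 0],
    [0, 0, 2, 1, 1, 0, 0, 2, 0, 0, 0],
    [0, 0, 0, 2, 0, 2, 0, 1, 0, 0, 0],
    [1, 0, 0, 0, 1, 2, 0, 0, 0, 0, 0],
    [0, 1, 2, 2, 2, 0, 0, 2, 0, 0, 0]]

set_option maxHeartbeats 800000 in
theorem formEightyNine_valid : formEightyNine.Valid where
  pos := by decide
  length_eq := rfl
  prime := by simp only [formEightyNine]; norm_num
  eisenstein := by decide +kernel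
  not_dvd := by decide +kernel
  value_eq := by
    simp only [formEightyNine, value_cons, value_nil, binomForm, evenPart, oddPart]
    push_cast
    ring
  check := by decide +kernel
  lead_length := by decide +kernel
  dual_eq := by decide +kernel

/-! ### Elements of prime norm -/

/-- **Thue's lemma** for a rectangular box. -/
theorem exists_small_congr {p X Y : ℕ} [NeZero p] (h : p < (X + 1) * (Y + 1)) (t : ℤ) :
    ∃ a b : ℤ, ¬ (a = 0 ∧ b = 0) ∧ |a| ≤ X ∧ |b| ≤ Y ∧ (p : ℤ) ∣ a - t * b := by
  obtain ⟨u, v, huv, heq⟩ := Fintype.exists_ne_map_eq_of_card_lt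
    (fun u : Fin (X + 1) × Fin (Y + 1) => ((u.1 : ℕ) : ZMod p) - t * ((u.2 : ℕ) : ZMod p))
    (by simpa [ZMod.card] using h)
  refine ⟨(u.1 : ℕ) - (v.1 : ℕ), (u.2 : ℕ) - (v.2 : ℕ), fun ⟨h1, h2⟩ => huv ?_, ?_, ?_, ?_⟩
  · exact Prod.ext (Fin.ext (by omega)) (Fin.ext (by omega))
  · rw [abs_le]; omega
  · rw [abs_le]; omega
  · rw [← ZMod.intCast_zmod_eq_zero_iff_dvd]
    push_cast
    linear_combination heq

theorem exists_small_norm {d s p : ℕ} {y : ℤ} (hp : p.Prime) (hp2 : p ≠ 2) (hs : d < (s + 1) ^ 2)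
    (hsq : ¬ IsSquare d) (hy : (p : ℤ) ∣ y ^ 2 - 4 * d) :
    ∃ a b : ℤ, ∃ m : ℕ, 1 ≤ m ∧ m ≤ s ∧ |a ^ 2 - d * b ^ 2| = m * p ∧ (p : ℤ) ∣ 2 * a - y * b := by
  have : NeZero p := ⟨hp.ne_zero⟩
  have hd : 0 < d := Nat.pos_of_ne_zero fun h => hsq (h ▸ IsSquare.zero)
  have hN : 0 < (s + 1) * p := Nat.mul_pos s.succ_pos hp.pos
  set X := Nat.sqrt ((s + 1) * p - 1) with hX
  set Y := Nat.sqrt (((s + 1) * p - 1) / d) with hY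
  have hX1 := Nat.sqrt_le' ((s + 1) * p - 1)
  have hX2 := Nat.lt_succ_sqrt' ((s + 1) * p - 1)
  have hY1 := Nat.sqrt_le' (((s + 1) * p - 1) / d)
  have hY2 := Nat.lt_succ_sqrt' (((s + 1) * p - 1) / d)
  rw [← hX] at hX1 hX2
  rw [← hY] at hY1 hY2
  rw [Nat.le_div_iff_mul_le hd] at hY1
  rw [Nat.div_lt_iff_lt_mul hd] at hY2
  simp only [Nat.succ_eq_add_one] at hX2 hY2
  have hXY : p < (X + 1) * (Y + 1) := by
    refine lt_of_pow_lt_pow_left₀ 2 (by positivity) ?_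
    refine lt_of_mul_lt_mul_left ?_ (Nat.zero_le d)
    calc d * p ^ 2 < (s + 1) ^ 2 * p ^ 2 :=
          Nat.mul_lt_mul_of_pos_right hs (pow_pos hp.pos 2)
      _ = ((s + 1) * p) * ((s + 1) * p) := by ring
      _ ≤ (X + 1) ^ 2 * ((Y + 1) ^ 2 * d) := Nat.mul_le_mul (by omega) (by omega)
      _ = d * ((X + 1) * (Y + 1)) ^ 2 := by ring
  obtain ⟨a, b, hab, ha, hb, hdvd⟩ := exists_small_congr hXY (y * ((p + 1) / 2 : ℕ))
  have hpodd : ((2 * ((p + 1) / 2) : ℕ) : ℤ) = p + 1 := by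
    have := hp.eq_two_or_odd
    exact_mod_cast (by omega : 2 * ((p + 1) / 2) = p + 1)
  have h2 : (p : ℤ) ∣ 2 * a - y * b := by
    have h3 : 2 * a - y * b = 2 * (a - y * ((p + 1) / 2 : ℕ) * b) + p * (y * b) := by
      push_cast at hpodd ⊢
      linear_combination y * b * hpodd
    rw [h3]
    exact dvd_add (hdvd.mul_left _) (dvd_mul_right _ _)
  have hcop : IsCoprime (p : ℤ) (2 ^ 2) := by
    refine IsCoprime.pow_right ?_
    exact_mod_cast Nat.isCoprime_iff_coprime.mpr ((Nat.coprime_primes hp Nat.prime_two).mpr hp2)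
  have h4 : (p : ℤ) ∣ a ^ 2 - d * b ^ 2 := by
    refine hcop.dvd_of_dvd_mul_left ?_
    have : 2 ^ 2 * (a ^ 2 - d * b ^ 2) =
        (2 * a - y * b) * (2 * a + y * b) + b ^ 2 * (y ^ 2 - 4 * d) := by ring
    rw [this]
    exact dvd_add (h2.mul_right _) (hy.mul_left _)
  obtain ⟨m, hm⟩ := (Int.natCast_dvd.mp h4)
  have hm' : |a ^ 2 - d * b ^ 2| = m * p := by
    rw [Int.abs_eq_natAbs, hm]
    push_cast
    ring
  refine ⟨a, b, m, Nat.one_le_iff_ne_zero.mpr fun h0 => ?_, ?_, hm', h2⟩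
  · rw [h0, Nat.cast_zero, zero_mul, abs_eq_zero, sub_eq_zero] at hm'
    have hb0 : b = 0 := by
      by_contra hb0
      refine hsq (Int.isSquare_natCast_iff.mp (Rat.isSquare_intCast_iff.mp ⟨a / b, ?_⟩))
      have : (b : ℚ) ≠ 0 := by exact_mod_cast hb0
      field_simp
      exact_mod_cast (by linarith : (d : ℤ) * b ^ 2 = a ^ 2)
    rw [hb0] at hm'
    exact hab ⟨by simpa using hm', hb0⟩
  · have ha2 : a ^ 2 ≤ (X : ℤ) ^ 2 := sq_le_sq' (abs_le.mp ha).1 (abs_le.mp ha).2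
    have hb2 : b ^ 2 ≤ (Y : ℤ) ^ 2 := sq_le_sq' (abs_le.mp hb).1 (abs_le.mp hb).2
    have hX3 : (X : ℤ) ^ 2 < (s + 1) * p := by
      exact_mod_cast (by omega : X ^ 2 < (s + 1) * p)
    have hY3 : (d : ℤ) * Y ^ 2 < (s + 1) * p := by
      rw [mul_comm]
      exact_mod_cast (by omega : Y ^ 2 * d < (s + 1) * p)
    have h5 : (m : ℤ) * p < (s + 1) * p := by
      rw [← hm', abs_lt]
      have := mul_le_mul_of_nonneg_left hb2 (Nat.cast_nonneg (α := ℤ) d)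
      have := mul_nonneg (Nat.cast_nonneg (α := ℤ) d) (sq_nonneg b)
      constructor <;> nlinarith [sq_nonneg a]
    exact Nat.lt_succ_iff.mp (by exact_mod_cast lt_of_mul_lt_mul_right h5 (Nat.cast_nonneg p))

/-- Every element `a + b√d` with the given residues and norm `± m * p` is divisible by a listed
element of norm `± m`, or `a` and `b` share the prime factor `3` or `7` with `m`. -/
def GensCheckAt (d : ℕ) (gens : List (ℤ × ℤ)) (m a b : ℕ) : Prop :=
  (∃ g ∈ gens, |g.1 ^ 2 - d * g.2 ^ 2| = m ∧ (a * g.1 - d * b * g.2) % m = 0 ∧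
    (b * g.1 - a * g.2) % m = 0) ∨
  (∃ q ∈ [3, 7], m % q = 0 ∧ m % (q ^ 2) ≠ 0 ∧ a % q = 0 ∧ b % q = 0)

instance GensCheckAt.decidable (d : ℕ) (gens : List (ℤ × ℤ)) (m a b : ℕ) :
    Decidable (GensCheckAt d gens m a b) := by
  unfold GensCheckAt; infer_instance

/-- The condition `GensCheckAt` for all norms up to `s` and all relevant residues. -/
def GensCheck (d s : ℕ) (gens : List (ℤ × ℤ)) : Prop :=
  ∀ m : ℕ, m < s + 1 → ∀ a : ℕ, a < 2 * m → ∀ b : ℕ, b < 2 * m →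
    ((a : ℤ) ^ 2 - d * b ^ 2 - m) % (2 * m) = 0 → GensCheckAt d gens m a b

instance GensCheck.decidable (d s : ℕ) (gens : List (ℤ × ℤ)) : Decidable (GensCheck d s gens) := by
  unfold GensCheck; infer_instance

theorem exists_prime_norm {d s p : ℕ} {y : ℤ} {gens : List (ℤ × ℤ)} (hp : p.Prime) (hp7 : 7 < p)
    (hs : d < (s + 1) ^ 2) (hsp : s < p) (hsq : ¬ IsSquare d) (hy : (p : ℤ) ∣ y ^ 2 - 4 * d)
    (hg : GensCheck d s gens) :
    ∃ ξ : ℤ√d, |ξ.norm| = p ∧ (p : ℤ) ∣ 2 * ξ.re - y * ξ.im := by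
  obtain ⟨a, b, m, hm1, hms, hab, h2⟩ := exists_small_norm hp (by omega) hs hsq hy
  have hm0 : (m : ℤ) ≠ 0 := by exact_mod_cast Nat.one_le_iff_ne_zero.mp hm1
  have hm2 : (0 : ℤ) < 2 * m := by positivity
  have ha0 := Int.emod_nonneg a hm2.ne'
  have hb0 := Int.emod_nonneg b hm2.ne'
  have ha1 := Int.emod_lt_of_pos a hm2
  have hb1 := Int.emod_lt_of_pos b hm2
  have hodd := hp.eq_two_or_odd
  obtain ⟨ca, hca⟩ : 2 * (m : ℤ) ∣ a - a % (2 * m) := Int.dvd_self_sub_emod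
  obtain ⟨cb, hcb⟩ : 2 * (m : ℤ) ∣ b - b % (2 * m) := Int.dvd_self_sub_emod
  lift a % (2 * m) to ℕ using ha0 with a' ha'
  lift b % (2 * m) to ℕ using hb0 with b' hb'
  obtain rfl : a = a' + 2 * m * ca := by linarith
  obtain rfl : b = b' + 2 * m * cb := by linarith
  have hpar : ((a' : ℤ) ^ 2 - d * b' ^ 2 - m) % (2 * m) = 0 := by
    obtain ⟨k, hk⟩ : ∃ k : ℤ, (p : ℤ) = 2 * k + 1 := ⟨p / 2, by omega⟩
    refine Int.emod_eq_zero_of_dvd ?_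
    rcases abs_choice ((a' + 2 * m * ca : ℤ) ^ 2 - d * (b' + 2 * m * cb) ^ 2) with h | h
    · rw [h, hk] at hab
      exact ⟨k - 2 * ca * a' - 2 * m * ca ^ 2 + d * (2 * cb * b' + 2 * m * cb ^ 2),
        by linear_combination hab⟩
    · rw [h, hk] at hab
      exact ⟨-k - 1 - 2 * ca * a' - 2 * m * ca ^ 2 + d * (2 * cb * b' + 2 * m * cb ^ 2),
        by linear_combination -hab⟩
  rcases hg m (by omega) a' (by omega) b' (by omega) hpar with ⟨⟨σ, t⟩, -, hn, h3, h4⟩ | ⟨q, hq, h⟩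
  · obtain ⟨u, hu⟩ := Int.dvd_of_emod_eq_zero h3
    obtain ⟨v, hv⟩ := Int.dvd_of_emod_eq_zero h4
    dsimp only at hn hu hv
    set a : ℤ := a' + 2 * m * ca with ha
    set b : ℤ := b' + 2 * m * cb with hb
    have hU : a * σ - d * b * t = m * (u + 2 * ca * σ - 2 * d * cb * t) := by
      rw [ha, hb]; linear_combination hu
    have hV : b * σ - a * t = m * (v + 2 * cb * σ - 2 * ca * t) := by
      rw [ha, hb]; linear_combination hv
    generalize u + 2 * ca * σ - 2 * d * cb * t = U at hU
    generalize v + 2 * cb * σ - 2 * ca * t = V at hV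
    refine ⟨⟨U, V⟩, ?_, ?_⟩
    · rw [Zsqrtd.norm_def]
      have h5 : (m : ℤ) ^ 2 * |U * U - d * V * V| = m ^ 2 * p := by
        rw [← abs_of_nonneg (sq_nonneg (m : ℤ)), ← abs_mul, abs_of_nonneg (sq_nonneg (m : ℤ))]
        have : (m : ℤ) ^ 2 * (U * U - d * V * V) = (a ^ 2 - d * b ^ 2) * (σ ^ 2 - d * t ^ 2) := by
          linear_combination -(a * σ - d * b * t + m * U) * hU + d * (b * σ - a * t + m * V) * hV
        rw [this, abs_mul, hab, hn]
        ring
      exact mul_left_cancel₀ (pow_ne_zero 2 hm0) h5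
    · have hcop : IsCoprime (p : ℤ) ((2 * m : ℕ) : ℤ) := by
        refine Nat.isCoprime_iff_coprime.mpr (Nat.Coprime.mul_right ?_ ?_)
        · exact (Nat.coprime_primes hp Nat.prime_two).mpr (by omega)
        · exact Nat.coprime_of_lt_prime (Nat.one_le_iff_ne_zero.mp hm1) (by omega) hp
      refine hcop.dvd_of_dvd_mul_left ?_
      have : ((2 * m : ℕ) : ℤ) * (2 * U - y * V) =
          (2 * σ + t * y) * (2 * a - y * b) + t * b * (y ^ 2 - 4 * d) := by
        push_cast
        linear_combination -4 * hU + 2 * y * hV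
      rw [this]
      exact dvd_add (h2.mul_left _) (hy.mul_left _)
  · exfalso
    obtain ⟨h3, h4, h5, h6⟩ := h
    have hq' : q.Prime ∧ q < p := by
      simp only [List.mem_cons, List.not_mem_nil, or_false] at hq
      rcases hq with rfl | rfl
      · exact ⟨by norm_num, by omega⟩
      · exact ⟨by norm_num, by omega⟩
    have hqm : (q : ℤ) ∣ m := Int.natCast_dvd_natCast.mpr (Nat.dvd_of_mod_eq_zero h3)
    have hqa : (q : ℤ) ∣ a' + 2 * m * ca := dvd_add
      (Int.natCast_dvd_natCast.mpr (Nat.dvd_of_mod_eq_zero h5)) ((hqm.mul_left _).mul_right _)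
    have hqb : (q : ℤ) ∣ b' + 2 * m * cb := dvd_add
      (Int.natCast_dvd_natCast.mpr (Nat.dvd_of_mod_eq_zero h6)) ((hqm.mul_left _).mul_right _)
    have h7 : ((q ^ 2 : ℕ) : ℤ) ∣ ((m * p : ℕ) : ℤ) := by
      push_cast
      rw [← hab, dvd_abs]
      exact dvd_sub (pow_dvd_pow_of_dvd hqa 2) ((pow_dvd_pow_of_dvd hqb 2).mul_left _)
    have h8 : Nat.Coprime (q ^ 2) p :=
      Nat.Coprime.pow_left 2 ((Nat.coprime_primes hq'.1 hp).mpr hq'.2.ne)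
    exact h4 (Nat.mod_eq_zero_of_dvd (h8.dvd_of_dvd_mul_right (Int.natCast_dvd_natCast.mp h7)))

/-! ### Descent to a perfect eleventh power -/

section

variable {d : ℕ} [Zsqrtd.Nonsquare d]

theorem exists_eq_pow_mul {p : ℕ} {y : ℤ} {ξ : ℤ√d} (hp : p.Prime) (hp2 : p ≠ 2)
    (hpy : ¬ (p : ℤ) ∣ y) (h : y ^ 2 = 5 * (p : ℤ) ^ 22 + 4 * d) (hξ : |ξ.norm| = p)
    (hdvd : (p : ℤ) ∣ 2 * ξ.re - y * ξ.im) :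
    ∃ w : ℤ√d, (⟨y, 2⟩ : ℤ√d) = ξ ^ 22 * w ∧ w.norm = 5 := by
  have hp0 : (p : ℤ) ≠ 0 := by exact_mod_cast hp.ne_zero
  have hpξ : ξ * star ξ = ξ.norm := (Zsqrtd.norm_eq_mul_conj ξ).symm
  have hnorm : (ξ.norm : ℤ√d) ∣ (p : ℤ) := by
    rcases abs_choice ξ.norm with h | h <;> rw [h] at hξ
    · rw [hξ]
    · rw [← hξ, Int.cast_neg, dvd_neg]
  have hξ0 : ξ ≠ 0 := by
    rintro rfl
    rw [Zsqrtd.norm_zero, abs_zero] at hξ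
    exact hp0 hξ.symm
  have hstar0 : star ξ ≠ 0 := star_ne_zero.mpr hξ0
  set z : ℤ√d := ⟨y, 2⟩ with hz
  have hzz : z.norm = 5 * (p : ℤ) ^ 22 := by
    rw [Zsqrtd.norm_def, hz]; linear_combination h
  have h1 : ((p : ℤ) : ℤ√d) ∣ z * star ξ := by
    rw [Zsqrtd.intCast_dvd]
    simp only [Zsqrtd.re_mul, Zsqrtd.im_mul, Zsqrtd.re_star, Zsqrtd.im_star, hz]
    constructor
    · have hcop : IsCoprime (p : ℤ) 2 := by
        exact_mod_cast Nat.isCoprime_iff_coprime.mpr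
          ((Nat.coprime_primes hp Nat.prime_two).mpr hp2)
      refine hcop.dvd_of_dvd_mul_left ?_
      have : 2 * (y * ξ.re + d * 2 * -ξ.im) = y * (2 * ξ.re - y * ξ.im) +
          ξ.im * (5 * (p : ℤ) ^ 22) := by linear_combination ξ.im * h
      rw [this]
      exact dvd_add (hdvd.mul_left _) (((dvd_pow_self _ (by decide)).mul_left _).mul_left _)
    · rwa [show y * -ξ.im + 2 * ξ.re = 2 * ξ.re - y * ξ.im by ring]
  have h2 : ξ ∣ z := by
    have h3 := hnorm.trans h1
    rw [← hpξ] at h3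
    exact (mul_dvd_mul_iff_right hstar0).mp h3
  have hcop : IsCoprime ξ (star z) := by
    have h3 : IsCoprime (p : ℤ) (2 * y) := by
      refine IsCoprime.mul_right ?_ ?_
      · exact_mod_cast Nat.isCoprime_iff_coprime.mpr
          ((Nat.coprime_primes hp Nat.prime_two).mpr hp2)
      · exact (Nat.prime_iff_prime_int.mp hp).coprime_iff_not_dvd.mpr hpy
    obtain ⟨u, v, huv⟩ := h3
    obtain ⟨k, hk⟩ : ξ ∣ ((p : ℤ) : ℤ√d) := (Dvd.intro _ hpξ).trans hnorm
    obtain ⟨l, hl⟩ := h2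
    refine ⟨u * k + v * l, v, ?_⟩
    have h4 : z + star z = ((2 * y : ℤ) : ℤ√d) := by
      ext <;> simp [hz]; ring
    have h5 : (u : ℤ√d) * (p : ℤ) + v * ((2 * y : ℤ) : ℤ√d) = 1 := by exact_mod_cast huv
    linear_combination h5 - (u : ℤ√d) * hk - (v : ℤ√d) * hl + (v : ℤ√d) * h4
  have h3 : ξ ^ 22 ∣ z * star z := by
    rw [← Zsqrtd.norm_eq_mul_conj, hzz]
    push_cast
    have : ξ ∣ ((p : ℤ) : ℤ√d) := (Dvd.intro _ hpξ).trans hnorm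
    exact (pow_dvd_pow_of_dvd (by exact_mod_cast this) 22).mul_left _
  obtain ⟨w, hw⟩ := (hcop.pow_left).dvd_of_dvd_mul_right h3
  refine ⟨w, hw, ?_⟩
  have h4 : ξ.norm ^ 22 = (p : ℤ) ^ 22 := by
    rw [← hξ]; exact (Even.pow_abs (by decide) _).symm
  have h5 : z.norm = (ξ.norm) ^ 22 * w.norm := by
    rw [hw, Zsqrtd.norm_mul]
    congr 1
    exact map_pow Zsqrtd.normMonoidHom ξ 22
  rw [h4, hzz, mul_comm] at h5
  exact (mul_left_cancel₀ (pow_ne_zero 22 hp0) h5).symm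

theorem exists_eq_mul_unit {p : ℕ} {y y₀ : ℤ} {ξ w : ℤ√d} (hp : p.Prime) (hp5 : p ≠ 5)
    (hξ : |ξ.norm| = p) (hy : (5 : ℤ) ∣ y - y₀) (h₀ : y₀ ^ 2 = 4 * d + 5)
    (hw : (⟨y, 2⟩ : ℤ√d) = ξ ^ 22 * w) (hwn : w.norm = 5) :
    ∃ θ : ℤ√d, θ.norm = 1 ∧ w = ⟨y₀, 2⟩ * θ := by
  set A : ℤ√d := ⟨y₀, 2⟩ with hA
  have hAn : A.norm = 5 := by rw [Zsqrtd.norm_def, hA]; linear_combination h₀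
  have hA2 : A * star A = 5 := by rw [← Zsqrtd.norm_eq_mul_conj, hAn]; norm_num
  have hA0 : star A ≠ 0 := by
    intro h
    rw [h, mul_zero] at hA2
    exact absurd hA2 (by norm_num)
  obtain ⟨k, hk⟩ := hy
  have hzA : (⟨y, 2⟩ : ℤ√d) = A + 5 * (k : ℤ√d) := by
    rw [hA]
    ext <;> simp
    linear_combination hk
  have hξ22 : ξ ^ 22 * star ξ ^ 22 = ((p : ℤ) ^ 22 : ℤ) := by
    rw [← mul_pow, ← Zsqrtd.norm_eq_mul_conj, ← hξ, Even.pow_abs (by decide)]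
    push_cast; rfl
  have h5 : (((5 : ℤ) : ℤ√d)) ∣ (((p : ℤ) ^ 22 : ℤ) : ℤ√d) * (w * star A) := by
    refine ⟨star ξ ^ 22 * (1 + k * star A), ?_⟩
    push_cast at hξ22 ⊢
    linear_combination -w * star A * hξ22 - star ξ ^ 22 * star A * hw +
      star ξ ^ 22 * star A * hzA + star ξ ^ 22 * hA2
  have h6 : (((5 : ℤ) : ℤ√d)) ∣ w * star A := by
    have hcop : IsCoprime (5 : ℤ) ((p : ℤ) ^ 22) := by
      refine IsCoprime.pow_right ?_
      exact_mod_cast Nat.isCoprime_iff_coprime.mpr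
        ((Nat.coprime_primes Nat.prime_five hp).mpr hp5.symm)
    exact (hcop.map (Int.castRingHom (ℤ√d))).dvd_of_dvd_mul_left h5
  obtain ⟨θ, hθ⟩ := h6
  have hθ' : w = A * θ := by
    refine mul_right_cancel₀ hA0 ?_
    rw [hθ]
    push_cast
    linear_combination -θ * hA2
  refine ⟨θ, ?_, hθ'⟩
  rw [hθ', Zsqrtd.norm_mul, hAn] at hwn
  linarith

end

/-- Residue data forcing a unit of norm one to be an eleventh power: `√d` is congruent to `root`
modulo a prime above `r`, and the power `e = (r - 1) / 11` of `pell` is nontrivial there. -/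
structure ResidueData where
  r : ℕ
  root : ℤ
  pell : ℤ × ℤ
  e : ℕ

/-- The verification of residue data for the parameters `d` and `y₀`. -/
structure ResidueData.Valid (E : ResidueData) (d : ℕ) : Prop where
  prime : E.r.Prime
  ne_five : E.r ≠ 5
  root_sq : (E.root : ZMod E.r) * E.root = (d : ℤ)
  even : Even E.e
  eq : E.r - 1 = 11 * E.e
  pell_norm : E.pell.1 ^ 2 - d * E.pell.2 ^ 2 = 1
  ne_one : ((E.pell.1 : ZMod E.r) + E.pell.2 * E.root) ^ E.e ≠ 1

theorem ResidueData.Valid.exists_pow_eleven {E : ResidueData} {d : ℕ} (hE : E.Valid d) (hd : 0 < d)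
    [hsq : Zsqrtd.Nonsquare d] {y y₀ : ℤ} {ξ θ : ℤ√d} (hθ : θ.norm = 1)
    (hy : (E.r : ℤ) ∣ y - y₀) (h₀ : y₀ ^ 2 = 4 * d + 5)
    (h : (⟨y, 2⟩ : ℤ√d) = ξ ^ 22 * (⟨y₀, 2⟩ * θ)) :
    ∃ β : ℤ√d, β.norm = 1 ∧ θ = β ^ 11 := by
  have : Fact E.r.Prime := ⟨hE.prime⟩
  set χ : ℤ√d →+* ZMod E.r := Zsqrtd.lift ⟨E.root, hE.root_sq⟩ with hχ
  have hχ_apply : ∀ a : ℤ√d, χ a = a.re + a.im * E.root := fun a => rfl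
  have hyy : (y : ZMod E.r) = y₀ := by
    rw [← sub_eq_zero]
    exact_mod_cast (ZMod.intCast_zmod_eq_zero_iff_dvd _ _).mpr hy
  have hA : χ ⟨y₀, 2⟩ ≠ 0 := by
    intro h0
    have h1 : χ ⟨y₀, 2⟩ * χ (star ⟨y₀, 2⟩) = ((5 : ℕ) : ZMod E.r) := by
      rw [← map_mul, ← Zsqrtd.norm_eq_mul_conj, map_intCast, Zsqrtd.norm_def]
      have : y₀ * y₀ - d * 2 * 2 = 5 := by linear_combination h₀
      rw [this]; norm_num
    rw [h0, zero_mul] at h1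
    exact hE.ne_five ((Nat.prime_dvd_prime_iff_eq hE.prime Nat.prime_five).mp
      ((ZMod.natCast_eq_zero_iff _ _).mp h1.symm))
  have h1 : χ ξ ^ 22 * χ θ = 1 := by
    refine mul_left_cancel₀ hA ?_
    have h2 := congr_arg χ h
    rw [map_mul, map_mul, map_pow, hχ_apply ⟨y, 2⟩] at h2
    have h3 := hχ_apply ⟨y₀, 2⟩
    dsimp only at h2 h3
    rw [hyy, ← h3] at h2
    linear_combination -h2
  have hξ0 : χ ξ ≠ 0 := by
    intro h0
    rw [h0, zero_pow (by decide), zero_mul] at h1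
    exact zero_ne_one h1
  have hθe : χ θ ^ E.e = 1 := by
    have h2 := congr_arg (· ^ E.e) h1
    simp only [mul_pow, one_pow] at h2
    rwa [← pow_mul, show 22 * E.e = (E.r - 1) * 2 by rw [hE.eq]; ring, pow_mul,
      ZMod.pow_card_sub_one_eq_one hξ0, one_pow, one_mul] at h2
  obtain ⟨η, hη⟩ := Pell.IsFundamental.exists_of_not_isSquare (d := (d : ℤ))
    (by exact_mod_cast hd) fun ⟨n, hn⟩ => hsq.ns n.natAbs (by
      have := congr_arg Int.natAbs hn
      rwa [Int.natAbs_mul, Int.natAbs_natCast] at this)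
  let f : Pell.Solution₁ (d : ℤ) →* (ZMod E.r)ˣ :=
    (powMonoidHom E.e).comp ((Units.map (χ : ℤ√d →* ZMod E.r)).comp Unitary.toUnits)
  have hf : ∀ a, ((f a : (ZMod E.r)ˣ) : ZMod E.r) = χ (a : ℤ√d) ^ E.e := fun a => rfl
  have hf1 : ∀ a, f (-a) = f a := fun a => by
    ext
    rw [hf, hf, show ((-a : Pell.Solution₁ (d : ℤ)) : ℤ√d) = -(a : ℤ√d) from rfl, map_neg,
      hE.even.neg_pow]
  have hf11 : ∀ a, f a ^ 11 = 1 := fun a => by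
    have h2 : f a ^ 11 = (Units.map (χ : ℤ√d →* ZMod E.r) (Unitary.toUnits a)) ^ (E.r - 1) := by
      rw [hE.eq, mul_comm, pow_mul]; rfl
    rw [h2, ZMod.units_pow_card_sub_one_eq_one]
  have hz : ∀ k : ℤ, f (η ^ k) = f η ^ k := fun k => map_zpow f η k
  have hfη : f η ≠ 1 := by
    intro h2
    refine hE.ne_one ?_
    have h3 : f (Pell.Solution₁.mk E.pell.1 E.pell.2 hE.pell_norm) = 1 := by
      obtain ⟨k, hk | hk⟩ := hη.eq_zpow_or_neg_zpow
        (Pell.Solution₁.mk E.pell.1 E.pell.2 hE.pell_norm) <;>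
      rw [hk]
      · rw [hz, h2, one_zpow]
      · rw [hf1, hz, h2, one_zpow]
    have h4 := congr_arg (Units.val) h3
    rw [hf] at h4
    exact h4
  have hord : orderOf (f η) = 11 := by
    have : Fact (Nat.Prime 11) := ⟨by norm_num⟩
    exact orderOf_eq_prime (hf11 η) hfη
  let θ' : Pell.Solution₁ (d : ℤ) := ⟨θ, by
    rw [← Pell.is_pell_solution_iff_mem_unitary]
    rw [Zsqrtd.norm_def] at hθ
    linear_combination hθ⟩
  have hfθ : f θ' = 1 := by
    ext; rw [hf]; exact hθe
  have hnorm : ∀ a : Pell.Solution₁ (d : ℤ), (a : ℤ√d).norm = 1 := fun a => by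
    rw [Zsqrtd.norm_def]
    have := Pell.is_pell_solution_iff_mem_unitary.mpr a.2
    linear_combination this
  have hdvd : ∀ k : ℤ, f (η ^ k) = 1 → ∃ j : ℤ, k = j * 11 := fun k hk => by
    rw [hz, ← orderOf_dvd_iff_zpow_eq_one, hord] at hk
    exact ⟨k / 11, by omega⟩
  obtain ⟨k, hk | hk⟩ := hη.eq_zpow_or_neg_zpow θ'
  · rw [hk] at hfθ
    obtain ⟨j, rfl⟩ := hdvd k hfθ
    refine ⟨((η ^ j : Pell.Solution₁ (d : ℤ)) : ℤ√d), hnorm _, ?_⟩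
    rw [zpow_mul] at hk
    exact congr_arg Subtype.val hk
  · rw [hk, hf1] at hfθ
    obtain ⟨j, rfl⟩ := hdvd k hfθ
    refine ⟨((-η ^ j : Pell.Solution₁ (d : ℤ)) : ℤ√d), hnorm _, ?_⟩
    rw [zpow_mul] at hk
    have h5 : θ' = (-η ^ j) ^ 11 := by
      rw [hk, Odd.neg_pow (by decide)]; rfl
    exact congr_arg Subtype.val h5

theorem oddPart_two_mul {R : Type*} [CommRing R] (d a c : R) :
    evenPart d a (2 * c) = evenPart (4 * d) a c ∧ oddPart d a (2 * c) = oddPart (4 * d) a c := by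
  simp only [evenPart, oddPart]
  constructor <;> ring

/-- If `a + b√d` has odd norm and `(y₀ + 2√d) * (a + b√d) ^ 11` has the form `y + 2√d`, then `b` is
even and the binary form takes the value one. -/
theorem exists_binomForm_eq_one {d : ℕ} (hd : Odd d) {y y₀ : ℤ} (hy₀ : Odd y₀) {β : ℤ√d}
    (hβ : Odd β.norm) (h : (⟨y, 2⟩ : ℤ√d) = ⟨y₀, 2⟩ * β ^ 11) :
    ∃ c, β.im = 2 * c ∧ binomForm (d : ℤ) y₀ β.re c = 1 ∧
      y = y₀ * evenPart (d : ℤ) β.re β.im + 2 * d * (β.im * oddPart (d : ℤ) β.re β.im) ∧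
      2 = 2 * evenPart (d : ℤ) β.re β.im + y₀ * (β.im * oddPart (d : ℤ) β.re β.im) := by
  obtain ⟨a, b⟩ := β
  dsimp only
  have hs : (Zsqrtd.sqrtd : ℤ√(d : ℤ)) ^ 2 = ((d : ℤ) : ℤ√(d : ℤ)) := by
    rw [sq, Zsqrtd.dmuld]
  have hpow : (⟨a, b⟩ : ℤ√(d : ℤ)) ^ 11 =
      ⟨evenPart (d : ℤ) a b, b * oddPart (d : ℤ) a b⟩ := by
    rw [Zsqrtd.decompose, mul_comm Zsqrtd.sqrtd, pow_eleven_eq hs, Zsqrtd.decompose]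
    simp only [evenPart, oddPart]
    push_cast
    ring
  rw [hpow] at h
  have hre := congr_arg Zsqrtd.re h
  have him := congr_arg Zsqrtd.im h
  simp only [Zsqrtd.re_mul, Zsqrtd.im_mul] at hre him
  have hb : Even b := by
    by_contra hb
    rw [Int.not_even_iff_odd] at hb
    have hd' : Odd (d : ℤ) := by exact_mod_cast hd
    have hprod : Odd (y₀ * (b * oddPart (d : ℤ) a b)) := by
      have ha : Even a := by
        rw [Zsqrtd.norm_def] at hβ
        by_contra ha
        rw [Int.not_even_iff_odd] at ha
        exact Int.not_even_iff_odd.mpr hβ ((ha.mul ha).sub_odd ((hd'.mul hb).mul hb))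
      refine hy₀.mul (hb.mul ?_)
      obtain ⟨k, hk⟩ := ha
      have h1 : oddPart (d : ℤ) a b = 2 * (k * (11 * a ^ 9 + 165 * a ^ 7 * d * b ^ 2 +
          462 * a ^ 5 * d ^ 2 * b ^ 4 + 330 * a ^ 3 * d ^ 3 * b ^ 6 + 55 * a * d ^ 4 * b ^ 8)) +
          d ^ 5 * b ^ 10 := by
        rw [oddPart, ← mul_assoc, ← two_mul] at *
        subst hk
        ring
      rw [h1]
      exact (even_two_mul _).add_odd ((hd'.pow).mul hb.pow)
    have h2 : y₀ * (b * oddPart (d : ℤ) a b) = 2 * (1 - evenPart (d : ℤ) a b) := by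
      linear_combination -him
    rw [h2] at hprod
    exact Int.not_even_iff_odd.mpr hprod (even_two_mul _)
  obtain ⟨c, hc⟩ := hb
  rw [← two_mul] at hc
  refine ⟨c, hc, ?_, by linear_combination hre, by linear_combination him⟩
  have hp := oddPart_two_mul (d : ℤ) a c
  rw [← hc] at hp
  rw [binomForm, ← hp.1, ← hp.2]
  have : 2 * (evenPart (d : ℤ) a b + y₀ * c * oddPart (d : ℤ) a b) = 2 * 1 := by
    linear_combination -him - y₀ * oddPart (d : ℤ) a b * hc
  exact mul_left_cancel₀ two_ne_zero this

/-- Everything besides `FormData` that is needed to treat one curve. -/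
structure DescentData extends ResidueData where
  s : ℕ
  gens : List (ℤ × ℤ)

/-- The verification of descent data for the parameters `d` and `y₀`. -/
structure DescentData.Valid (E : DescentData) (d : ℕ) (y₀ : ℤ) : Prop
    extends E.toResidueData.Valid d where
  prime_d : d.Prime
  odd_d : Odd d
  sq_eq : y₀ ^ 2 = 4 * d + 5
  lt_sq : d < (E.s + 1) ^ 2
  le_ten : E.s ≤ 10
  gensCheck : GensCheck d E.s E.gens
  mod_three : ∀ a b : ZMod 3,
    y₀ * evenPart (d : ZMod 3) a b + 2 * d * (b * oddPart (d : ZMod 3) a b) = y₀ →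
    2 = 2 * evenPart (d : ZMod 3) a b + y₀ * (b * oddPart (d : ZMod 3) a b) → a = 1 ∧ b = 0
  small : ∀ p ∈ [3, 5, 7], ∃ q ∈ [3, 5, 7, 9, 11, 13, 19], ∀ x < q,
    x ^ 2 % q ≠ (5 * p ^ 22 + 4 * d) % q

theorem eq_one_of_descent {D : FormData} (hD : D.Valid) {E : DescentData} (hE : E.Valid D.d D.y)
    {y : ℤ} {β : ℤ√D.d} (hy : 3 ∣ y - D.y) (hβ : Odd β.norm)
    (h : (⟨y, 2⟩ : ℤ√D.d) = ⟨D.y, 2⟩ * β ^ 11) : β.norm = 1 := by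
  have hodd : Odd D.y := by
    have h1 : Odd (D.y ^ 2) := by
      rw [hE.sq_eq]
      exact ((by decide : Even (4 : ℤ)).mul_right _).add_odd (by decide)
    exact (Int.odd_pow.mp h1).resolve_right (by decide)
  obtain ⟨c, hc, hform, hre, him⟩ := exists_binomForm_eq_one hE.odd_d hodd hβ h
  have hyy : (y : ZMod 3) = D.y := by
    rw [← sub_eq_zero]
    exact_mod_cast (ZMod.intCast_zmod_eq_zero_iff_dvd _ 3).mpr hy
  have hcast : ∀ u v : ℤ, u = v → (u : ZMod 3) = v := fun u v h => by rw [h]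
  have hre3 := hcast _ _ hre
  have him3 := hcast _ _ him
  simp only [evenPart, oddPart] at hre3 him3
  push_cast at hre3 him3
  obtain ⟨ha, hb⟩ := hE.mod_three β.re β.im (by rw [← hyy, hyy, evenPart, oddPart, ← hre3, hyy])
    (by rw [evenPart, oddPart]; exact him3)
  have ha3 : 3 ∣ β.re - 1 := by
    refine (ZMod.intCast_zmod_eq_zero_iff_dvd _ 3).mp ?_
    push_cast
    rw [ha, sub_self]
  have hc3 : 3 ∣ c := by
    have : (3 : ℤ) ∣ β.im := (ZMod.intCast_zmod_eq_zero_iff_dvd _ 3).mp hb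
    omega
  obtain ⟨h1, h2⟩ := hD.eq_one hform ha3 hc3
  rw [Zsqrtd.norm_def, hc, h1, h2]
  ring

/-- A curve with valid data has no point over `p` whose ordinate has the given residues. -/
theorem ne_of_valid {D : FormData} (hD : D.Valid) {E : DescentData} (hE : E.Valid D.d D.y)
    {p : ℕ} (hp : p.Prime) (hpodd : Odd p) {y : ℤ} (h3 : 3 ∣ y - D.y) (h5 : 5 ∣ y - D.y)
    (hr : (E.r : ℤ) ∣ y - D.y) : y ^ 2 ≠ 5 * (p : ℤ) ^ 22 + 4 * D.d := by
  intro h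
  have hsq : ¬ IsSquare D.d := hE.prime_d.prime.irreducible.not_isSquare
  have : Zsqrtd.Nonsquare D.d := ⟨fun n hn => hsq ⟨n, hn⟩⟩
  have hp2 : p ≠ 2 := by rintro rfl; exact absurd hpodd (by decide)
  have hp10 : 10 < p := by
    by_contra hle
    have hmem : p ∈ [3, 5, 7] := by
      have h2 := hp.two_le
      push Not at hle
      interval_cases p <;> first | decide | exact absurd rfl hp2 | exact absurd hp (by norm_num)
    obtain ⟨q, hq, hx⟩ := hE.small p hmem
    have hq0 : 0 < q := by
      simp only [List.mem_cons, List.not_mem_nil, or_false] at hq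
      omega
    refine hx (y.natAbs % q) (Nat.mod_lt _ hq0) ?_
    rw [← Nat.pow_mod]
    congr 1
    zify
    rw [sq_abs, h]
  have hpd : ¬ p ∣ D.d := by
    intro hdvd
    have hpd := (Nat.prime_dvd_prime_iff_eq hp hE.prime_d).mp hdvd
    rw [← hpd] at h
    have h1 : (p : ℤ) ∣ y := by
      refine (Nat.prime_iff_prime_int.mp hp).dvd_of_dvd_pow (n := 2) ?_
      rw [h]
      exact dvd_add (dvd_mul_of_dvd_right (dvd_pow_self _ (by decide)) _) (dvd_mul_left _ _)
    obtain ⟨k, hk⟩ := h1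
    have h2 : (p : ℤ) * (p * (k ^ 2 - 5 * p ^ 20)) = p * 4 := by
      rw [hk] at h
      linear_combination h
    have h3 := mul_left_cancel₀ (by exact_mod_cast hp.ne_zero) h2
    have h4 := Int.le_of_dvd (by norm_num) (Dvd.intro _ h3)
    omega
  have hpy : ¬ (p : ℤ) ∣ y := by
    intro hdvd
    have h1 : (p : ℤ) ∣ ((4 * D.d : ℕ) : ℤ) := by
      have : ((4 * D.d : ℕ) : ℤ) = y ^ 2 - 5 * (p : ℤ) ^ 22 := by push_cast; linarith
      rw [this]
      exact dvd_sub (dvd_pow hdvd (by decide))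
        (dvd_mul_of_dvd_right (dvd_pow_self _ (by decide)) _)
    rcases hp.dvd_mul.mp (Int.natCast_dvd_natCast.mp h1) with h4 | h4
    · have := Nat.le_of_dvd (by norm_num) h4
      omega
    · exact hpd h4
  have hs := hE.le_ten
  obtain ⟨ξ, hξ, hdvd⟩ := exists_prime_norm (y := y) hp (by omega) hE.lt_sq (by omega) hsq
    (by rw [h, add_sub_cancel_right]
        exact dvd_mul_of_dvd_right (dvd_pow_self _ (by decide)) _) hE.gensCheck
  obtain ⟨w, hw, hwn⟩ := exists_eq_pow_mul hp hp2 hpy h hξ hdvd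
  obtain ⟨θ, hθ, rfl⟩ := exists_eq_mul_unit hp (by omega) hξ h5 hE.sq_eq hw hwn
  obtain ⟨β, hβ, rfl⟩ := hE.toValid.exists_pow_eleven hE.prime_d.pos hθ hr hE.sq_eq hw
  have hnorm : (ξ ^ 2 * β).norm = (p : ℤ) ^ 2 := by
    rw [Zsqrtd.norm_mul, hβ, mul_one, ← hξ, sq_abs]
    exact map_pow Zsqrtd.normMonoidHom ξ 2
  have h1 := eq_one_of_descent hD hE h3 (β := ξ ^ 2 * β)
    (by rw [hnorm]; exact Odd.pow (by exact_mod_cast hpodd)) (by rw [hw]; ring)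
  rw [hnorm] at h1
  have : (1 : ℤ) < p := by omega
  nlinarith

/-! ### Descent data for the seven primes -/

/-- The descent data for the prime 5. -/
def descentFive : DescentData where
  r := 89
  root := 19
  pell := (9, 4)
  e := 8
  s := 2
  gens := [(1, 0)]

theorem descentFive_valid : descentFive.Valid formFive.d formFive.y where
  prime := by norm_num [descentFive]
  ne_five := by decide
  root_sq := by decide +kernel
  even := by decide
  eq := by decide
  pell_norm := by decide
  ne_one := by decide +kernel
  prime_d := by norm_num [formFive]
  odd_d := by decide
  sq_eq := by decide
  lt_sq := by decide
  le_ten := by decide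
  gensCheck := by decide +kernel
  mod_three := by decide +kernel
  small := by decide +kernel

/-- The descent data for the prime 11. -/
def descentEleven : DescentData where
  r := 89
  root := 10
  pell := (10, 3)
  e := 8
  s := 3
  gens := [(1, 0), (3, 1)]

theorem descentEleven_valid : descentEleven.Valid formEleven.d formEleven.y where
  prime := by norm_num [descentEleven]
  ne_five := by decide
  root_sq := by decide +kernel
  even := by decide
  eq := by decide
  pell_norm := by decide
  ne_one := by decide +kernel
  prime_d := by norm_num [formEleven]
  odd_d := by decide
  sq_eq := by decide
  lt_sq := by decide
  le_ten := by decide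
  gensCheck := by decide +kernel
  mod_three := by decide +kernel
  small := by decide +kernel

/-- The descent data for the prime 19. -/
def descentNineteen : DescentData where
  r := 331
  root := 130
  pell := (170, 39)
  e := 30
  s := 4
  gens := [(1, 0), (13, 3), (4, 1), (4, -1), (2, 0)]

theorem descentNineteen_valid : descentNineteen.Valid formNineteen.d formNineteen.y where
  prime := by norm_num [descentNineteen]
  ne_five := by decide
  root_sq := by decide +kernel
  even := by decide
  eq := by decide
  pell_norm := by decide
  ne_one := by decide +kernel
  prime_d := by norm_num [formNineteen]
  odd_d := by decide
  sq_eq := by decide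
  lt_sq := by decide
  le_ten := by decide
  gensCheck := by decide +kernel
  mod_three := by decide +kernel
  small := by decide +kernel

/-- The descent data for the prime 29. -/
def descentTwentyNine : DescentData where
  r := 199
  root := 32
  pell := (9801, 1820)
  e := 18
  s := 5
  gens := [(1, 0), (2, 0), (5, 1), (5, -1), (11, 2), (11, -2)]

theorem descentTwentyNine_valid : descentTwentyNine.Valid formTwentyNine.d formTwentyNine.y where
  prime := by norm_num [descentTwentyNine]
  ne_five := by decide
  root_sq := by decide +kernel
  even := by decide
  eq := by decide
  pell_norm := by decide
  ne_one := by decide +kernel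
  prime_d := by norm_num [formTwentyNine]
  odd_d := by decide
  sq_eq := by decide
  lt_sq := by decide
  le_ten := by decide
  gensCheck := by decide +kernel
  mod_three := by decide +kernel
  small := by decide +kernel

/-- The descent data for the prime 41. -/
def descentFortyOne : DescentData where
  r := 661
  root := 73
  pell := (2049, 320)
  e := 60
  s := 6
  gens := [(1, 0), (2, 0), (6, 1), (6, -1)]

theorem descentFortyOne_valid : descentFortyOne.Valid formFortyOne.d formFortyOne.y where
  prime := by norm_num [descentFortyOne]
  ne_five := by decide
  root_sq := by decide +kernel
  even := by decide
  eq := by decide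
  pell_norm := by decide
  ne_one := by decide +kernel
  prime_d := by norm_num [formFortyOne]
  odd_d := by decide
  sq_eq := by decide
  lt_sq := by decide
  le_ten := by decide
  gensCheck := by decide +kernel
  mod_three := by decide +kernel
  small := by decide +kernel

/-- The descent data for the prime 71. -/
def descentSeventyOne : DescentData where
  r := 89
  root := 31
  pell := (3480, 413)
  e := 8
  s := 8
  gens := [(1, 0), (59, 7), (2, 0), (17, 2), (17, -2), (8, 1), (8, -1), (118, 14)]

theorem descentSeventyOne_valid : descentSeventyOne.Valid formSeventyOne.d formSeventyOne.y where
  prime := by norm_num [descentSeventyOne]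
  ne_five := by decide
  root_sq := by decide +kernel
  even := by decide
  eq := by decide
  pell_norm := by decide
  ne_one := by decide +kernel
  prime_d := by norm_num [formSeventyOne]
  odd_d := by decide
  sq_eq := by decide
  lt_sq := by decide
  le_ten := by decide
  gensCheck := by decide +kernel
  mod_three := by decide +kernel
  small := by decide +kernel

/-- The descent data for the prime 89. -/
def descentEightyNine : DescentData where
  r := 199
  root := 41
  pell := (500001, 53000)
  e := 18
  s := 9
  gens := [(1, 0), (2, 0), (19, 2), (19, -2), (9, 1), (9, -1), (3, 0)]

theorem descentEightyNine_valid : descentEightyNine.Valid formEightyNine.d formEightyNine.y where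
  prime := by norm_num [descentEightyNine]
  ne_five := by decide
  root_sq := by decide +kernel
  even := by decide
  eq := by decide
  pell_norm := by decide
  ne_one := by decide +kernel
  prime_d := by norm_num [formEightyNine]
  odd_d := by decide
  sq_eq := by decide
  lt_sq := by decide
  le_ten := by decide
  gensCheck := by decide +kernel
  mod_three := by decide +kernel
  small := by decide +kernel

/-! ### Sieving the powers among the solutions of `y ^ 2 = 5 * x ^ 2 + 4 * c` -/

/-- The common modulus of all congruences used by the sieve. -/
def sieveModulus : ℕ := 8368229698210186776345

/-- The moduli `r` and exponents `k` with `(p ^ 11) ^ k % r ≤ 1` for all `p`. -/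
def powerTests : List (ℕ × ℕ) := [(121, 10), (23, 2), (331, 30), (1321, 120), (39161, 3560)]

/-- The test whether `x` may be an eleventh power. -/
def maybePow (x : ℕ) : Bool := powerTests.all fun t => Nat.ble ((x % t.1) ^ t.2 % t.1) 1

/-- The test whether `2 * w + x` is congruent to `± y₀` modulo `m` for a listed pair `(m, y₀)`. -/
def isTarget (targets : List (ℕ × ℕ)) (w x : ℕ) : Bool :=
  targets.any fun t => Nat.beq ((2 * w + x) % t.1) (t.2 % t.1) ||
    Nat.beq ((2 * w + x + t.2) % t.1) 0

/-- Application of a function after evaluating its argument to a numeral. -/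
def forceNat {α : Type} (f : ℕ → α) (n : ℕ) : α := Nat.rec (f 0) (fun k _ => f (k + 1)) n

theorem forceNat_eq {α : Type} (f : ℕ → α) (n : ℕ) : forceNat f n = f n := by
  cases n <;> rfl

/-- The check of `n` consecutive states `(w, x)` modulo `sieveModulus`, the last of which has to
step to `(w₀, x₀)`. -/
def sieveLoop (targets : List (ℕ × ℕ)) (w₀ x₀ n : ℕ) : ℕ → ℕ → Bool :=
  Nat.rec (fun w x => Nat.beq w w₀ && Nat.beq x x₀)
    (fun _ ih w x => (!maybePow x || isTarget targets w x) &&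
      forceNat (fun w' => forceNat (ih w') ((w + 2 * x) % sieveModulus))
        ((w + x) % sieveModulus)) n

/-- The check of all orbits of solutions of `y ^ 2 = 5 * x ^ 2 + 4 * c`. -/
def SieveCheck (c : ℤ) (targets : List (ℕ × ℕ)) : Prop :=
  ∀ x : ℕ, x < 14 → ∀ y : ℕ, y < 40 → (y : ℤ) ^ 2 = 5 * (x : ℤ) ^ 2 + 4 * c →
    forceNat (fun w => sieveLoop targets w x 1320 w x) (((y - x : ℤ) / 2) % sieveModulus).toNat =
      true

instance SieveCheck.decidable (c : ℤ) (targets : List (ℕ × ℕ)) :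
    Decidable (SieveCheck c targets) := by
  unfold SieveCheck; infer_instance

theorem maybePow_pow_eleven (p : ℕ) : maybePow (p ^ 11 % sieveModulus) = true := by
  have key : ∀ r k : ℕ, r ∣ sieveModulus → (∀ p : ℕ, p ^ (11 * k) % r ≤ 1) →
      Nat.ble ((p ^ 11 % sieveModulus % r) ^ k % r) 1 = true := fun r k hr h => by
    rw [Nat.mod_mod_of_dvd _ hr, ← Nat.pow_mod, ← pow_mul]
    exact Nat.ble_eq.mpr (h p)
  have hprime : ∀ r k : ℕ, r.Prime → 1 < r → r - 1 = 11 * k → k ≠ 0 →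
      ∀ p : ℕ, p ^ (11 * k) % r ≤ 1 := fun r k hr h1 hk hk0 p => by
    by_cases hp : r ∣ p
    · rw [Nat.mod_eq_zero_of_dvd (dvd_pow hp (by omega))]
      exact zero_le_one
    · have h2 := Nat.ModEq.pow_totient ((hr.coprime_iff_not_dvd.mpr hp).symm)
      rw [Nat.totient_prime hr, hk, Nat.ModEq, Nat.mod_eq_of_lt h1] at h2
      exact h2.le
  have h121 : ∀ p : ℕ, p ^ (11 * 10) % 121 ≤ 1 := fun p => by
    rw [Nat.pow_mod]
    exact (by decide +kernel : ∀ a : ℕ, a < 121 → a ^ (11 * 10) % 121 ≤ 1) _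
      (Nat.mod_lt _ (by norm_num))
  simp only [maybePow, powerTests, List.all_cons, List.all_nil, Bool.and_true, Bool.and_eq_true]
  refine ⟨key _ _ (by decide) h121, key _ _ (by decide) ?_, key _ _ (by decide) ?_,
    key _ _ (by decide) ?_, key _ _ (by decide) ?_⟩ <;>
  exact hprime _ _ (by norm_num) (by norm_num) (by norm_num) (by norm_num)

/-- The unit step `(w, x) ↦ (w + x, w + 2 * x)` on solutions, where `y = 2 * w + x`. -/
def unitStep (s : ℤ × ℤ) : ℤ × ℤ := (s.1 + s.2, s.1 + 2 * s.2)

/-- The unit step on residues. -/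
def residueStep (s : ℕ × ℕ) : ℕ × ℕ :=
  ((s.1 + s.2) % sieveModulus, (s.1 + 2 * s.2) % sieveModulus)

/-- The least nonnegative residue modulo `sieveModulus`. -/
def residue (u : ℤ) : ℕ := (u % sieveModulus).toNat

theorem residue_cast (u : ℤ) : (residue u : ℤ) = u % sieveModulus :=
  Int.toNat_of_nonneg (Int.emod_nonneg u (by decide))

theorem residue_natCast (n : ℕ) : residue n = n % sieveModulus := by
  rw [← Int.natCast_inj, residue_cast, Int.natCast_mod]

/-- Reduction modulo `sieveModulus`. -/
def reduceState (s : ℤ × ℤ) : ℕ × ℕ := (residue s.1, residue s.2)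

theorem reduceState_unitStep (s : ℤ × ℤ) :
    reduceState (unitStep s) = residueStep (reduceState s) := by
  simp only [reduceState, unitStep, residueStep, Prod.mk.injEq]
  constructor <;>
  · rw [← Int.natCast_inj]
    push_cast [residue_cast]
    simp [Int.add_emod, Int.mul_emod]

theorem sieveLoop_spec {targets : List (ℕ × ℕ)} {w₀ x₀ n w x : ℕ}
    (h : sieveLoop targets w₀ x₀ n w x = true) :
    residueStep^[n] (w, x) = (w₀, x₀) ∧ ∀ k < n, maybePow (residueStep^[k] (w, x)).2 = true →
      isTarget targets (residueStep^[k] (w, x)).1 (residueStep^[k] (w, x)).2 = true := by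
  induction n generalizing w x with
  | zero =>
    have h' : (Nat.beq w w₀ && Nat.beq x x₀) = true := h
    rw [Bool.and_eq_true, Nat.beq_eq, Nat.beq_eq] at h'
    exact ⟨Prod.ext h'.1 h'.2, fun k hk => absurd hk (Nat.not_lt_zero k)⟩
  | succ n ih =>
    have h' : ((!maybePow x || isTarget targets w x) &&
      forceNat (fun w' => forceNat (sieveLoop targets w₀ x₀ n w') ((w + 2 * x) % sieveModulus))
        ((w + x) % sieveModulus)) = true := h
    rw [Bool.and_eq_true, forceNat_eq, forceNat_eq] at h'
    obtain ⟨h1, h2⟩ := ih h'.2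
    refine ⟨h1, fun k hk hpow => ?_⟩
    cases k with
    | zero => simpa [show maybePow x = true from hpow] using h'.1
    | succ k => exact h2 k (Nat.lt_of_succ_lt_succ hk) hpow

/-- Every solution with nonnegative coordinates arises from a small one by unit steps. -/
theorem exists_iterate_unitStep {c : ℤ} (hc : |c| < 100) (x : ℕ) (y : ℕ)
    (h : (y : ℤ) ^ 2 = 5 * (x : ℤ) ^ 2 + 4 * c) :
    ∃ x₀ : ℕ, x₀ < 14 ∧ ∃ y₀ : ℕ, y₀ < 40 ∧ (y₀ : ℤ) ^ 2 = 5 * (x₀ : ℤ) ^ 2 + 4 * c ∧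
      ∃ n, unitStep^[n] ((y₀ - x₀ : ℤ) / 2, x₀) = ((y - x : ℤ) / 2, (x : ℤ)) := by
  induction x using Nat.strong_induction_on generalizing y with
  | _ x ih =>
  obtain ⟨hc1, hc2⟩ := abs_lt.mp hc
  by_cases hx : x < 14
  · refine ⟨x, hx, y, ?_, h, 0, rfl⟩
    by_contra hy
    nlinarith
  · push Not at hx
    have hx' : (14 : ℤ) ≤ x := by exact_mod_cast hx
    have hy0 : (0 : ℤ) ≤ y := Nat.cast_nonneg y
    have hpar : ∃ k : ℤ, (y : ℤ) = x + 2 * k := by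
      have h1 : Even ((y : ℤ) ^ 2 + x ^ 2) := ⟨3 * x ^ 2 + 2 * c, by linear_combination h⟩
      have h2 : Even ((y : ℤ) - x) := by
        simpa [Int.even_add, Int.even_sub, Int.even_pow] using h1
      obtain ⟨k, hk⟩ := h2
      exact ⟨k, by linarith⟩
    obtain ⟨k, hk⟩ := hpar
    have h1 : 5 * (x : ℤ) ≤ 3 * y := by
      refine le_of_sq_le_sq ?_ (by positivity)
      nlinarith
    have h2 : (y : ℤ) ≤ 3 * x := by
      refine le_of_sq_le_sq ?_ (by positivity)
      nlinarith
    have h3 : (x : ℤ) < y := by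
      refine lt_of_pow_lt_pow_left₀ 2 (by positivity) ?_
      nlinarith
    have hx2 : ((x - k : ℤ).toNat : ℤ) = x - k := Int.toNat_of_nonneg (by omega)
    have hy2 : ((3 * k - x : ℤ).toNat : ℤ) = 3 * k - x := Int.toNat_of_nonneg (by omega)
    obtain ⟨x₀, hx₀, y₀, hy₀, h₀, n, hn⟩ := ih (x - k : ℤ).toNat (by omega) (3 * k - x : ℤ).toNat
      (by rw [hx2, hy2]; rw [hk] at h; linear_combination h)
    refine ⟨x₀, hx₀, y₀, hy₀, h₀, n + 1, ?_⟩
    rw [Function.iterate_succ_apply', hn, unitStep, Prod.mk.injEq]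
    constructor <;> dsimp only <;> omega

theorem exists_target {c : ℤ} (hc : |c| < 100) {targets : List (ℕ × ℕ)}
    (hs : SieveCheck c targets) (hdvd : ∀ t ∈ targets, t.1 ∣ sieveModulus) {p y : ℕ}
    (h : (y : ℤ) ^ 2 = 5 * (p : ℤ) ^ 22 + 4 * c) :
    ∃ t ∈ targets, (t.1 : ℤ) ∣ y - t.2 ∨ (t.1 : ℤ) ∣ y + t.2 := by
  obtain ⟨x₀, hx₀, y₀, hy₀, h₀, n, hn⟩ := exists_iterate_unitStep hc (p ^ 11) y
    (by push_cast; linear_combination h)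
  have hloop := hs x₀ hx₀ y₀ hy₀ h₀
  rw [forceNat_eq] at hloop
  change sieveLoop targets (residue _) x₀ 1320 (residue _) x₀ = true at hloop
  obtain ⟨hper, hgood⟩ := sieveLoop_spec hloop
  have hred : reduceState ((y₀ - x₀ : ℤ) / 2, x₀) =
      (residue ((y₀ - x₀ : ℤ) / 2), x₀) := by
    rw [reduceState, residue_natCast, Nat.mod_eq_of_lt (hx₀.trans (by decide))]
  have hiter := Function.Semiconj.iterate_right (f := reduceState) (ga := unitStep)
    (gb := residueStep) reduceState_unitStep n ((y₀ - x₀ : ℤ) / 2, (x₀ : ℤ))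
  rw [hn, hred] at hiter
  have hper' : Function.IsPeriodicPt residueStep 1320
    (residue ((y₀ - x₀ : ℤ) / 2), x₀) := hper
  rw [← hper'.iterate_mod_apply] at hiter
  have hgood' := hgood (n % 1320) (Nat.mod_lt _ (by norm_num))
  rw [← hiter] at hgood'
  have hx : (reduceState ((y - (p ^ 11 : ℕ) : ℤ) / 2, ((p ^ 11 : ℕ) : ℤ))).2 =
      p ^ 11 % sieveModulus := residue_natCast _
  rw [hx] at hgood'
  have htarget := hgood' (maybePow_pow_eleven p)
  rw [isTarget, List.any_eq_true] at htarget
  obtain ⟨t, ht, hmod⟩ := htarget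
  refine ⟨t, ht, ?_⟩
  have hpar : ∃ k : ℤ, (y : ℤ) = (p ^ 11 : ℕ) + 2 * k := by
    have h1 : Even ((y : ℤ) ^ 2 + (p ^ 11 : ℕ) ^ 2) :=
      ⟨3 * (p : ℤ) ^ 22 + 2 * c, by push_cast; linear_combination h⟩
    have h2 : Even ((y : ℤ) - (p ^ 11 : ℕ)) := by
      rw [Int.even_add, Int.even_pow' two_ne_zero, Int.even_pow' two_ne_zero] at h1
      rw [Int.even_sub]
      exact h1
    obtain ⟨k, hk⟩ := h2
    exact ⟨k, by linarith⟩
  obtain ⟨k, hk⟩ := hpar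
  generalize p ^ 11 = X at *
  have hM : ((t.1 : ℕ) : ℤ) ∣ sieveModulus := Int.natCast_dvd_natCast.mpr (hdvd t ht)
  have hw : (((reduceState ((y - (X : ℕ) : ℤ) / 2, (X : ℤ))).1 : ℕ) : ℤ) = k % sieveModulus := by
    rw [← residue_cast]
    exact congr_arg (fun u => (residue u : ℤ)) (by omega)
  have hw' : ((t.1 : ℕ) : ℤ) ∣ k - (reduceState ((y - (X : ℕ) : ℤ) / 2, (X : ℤ))).1 := by
    rw [hw]
    exact hM.trans Int.dvd_self_sub_emod
  have hX' : ((t.1 : ℕ) : ℤ) ∣ X - (X % sieveModulus : ℕ) := by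
    rw [Int.natCast_mod]
    exact hM.trans Int.dvd_self_sub_emod
  generalize (reduceState ((y - (X : ℕ) : ℤ) / 2, (X : ℤ))).1 = W at *
  have hsum := dvd_add (hw'.mul_left 2) hX'
  rw [Bool.or_eq_true, Nat.beq_eq, Nat.beq_eq] at hmod
  rcases hmod with hmod | hmod
  · left
    have h1 := Nat.modEq_iff_dvd.mp (Nat.ModEq.symm hmod)
    push_cast at h1
    have h2 := dvd_add hsum h1
    rwa [hk, show (X : ℤ) + 2 * k - t.2 = 2 * (k - W) + (X - (X % sieveModulus : ℕ)) +
      (2 * W + X % (sieveModulus : ℕ) - t.2) by push_cast; ring]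
  · right
    have h1 := Int.natCast_dvd_natCast.mpr (Nat.dvd_of_mod_eq_zero hmod)
    push_cast at h1
    have h2 := dvd_add hsum h1
    rwa [hk, show (X : ℤ) + 2 * k + t.2 = 2 * (k - W) + (X - (X % sieveModulus : ℕ)) +
      (2 * W + X % (sieveModulus : ℕ) + t.2) by push_cast; ring]

theorem ne_of_sieveCheck {D : FormData} (hD : D.Valid) {E : DescentData} (hE : E.Valid D.d D.y)
    {y₀ : ℕ} (hy₀ : D.y = y₀) (hd : D.d < 100) (hr : 15 * E.r ∣ sieveModulus)
    (hs : SieveCheck D.d [(15 * E.r, y₀)]) {p : ℕ} (hp : p.Prime) (hpodd : Odd p) (y : ℤ) :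
    y ^ 2 ≠ 5 * (p : ℤ) ^ 22 + 4 * D.d := by
  intro h
  obtain ⟨t, ht, hdvd⟩ := exists_target (c := D.d) (p := p) (y := y.natAbs)
    (by rw [Nat.abs_cast]; exact_mod_cast hd) hs
    (fun t ht => by rw [List.mem_singleton.mp ht]; exact hr) (by rw [Int.natAbs_sq, h])
  rw [List.mem_singleton.mp ht] at hdvd
  have key : ∀ u : ℤ, u ^ 2 = y ^ 2 → ((15 * E.r : ℕ) : ℤ) ∣ u - D.y → False := fun u hu hdvd =>
    ne_of_valid hD hE hp hpodd (y := u)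
      ((Dvd.intro (5 * (E.r : ℤ)) (by push_cast; ring)).trans hdvd)
      ((Dvd.intro (3 * (E.r : ℤ)) (by push_cast; ring)).trans hdvd)
      ((Dvd.intro_left (15 : ℤ) (by push_cast; ring)).trans hdvd) (hu.trans h)
  rcases hdvd with hdvd | hdvd
  · exact key y.natAbs (Int.natAbs_sq y) (hy₀ ▸ hdvd)
  · refine key (-y.natAbs) (by rw [neg_sq, Int.natAbs_sq]) ?_
    rw [hy₀, ← dvd_neg, neg_sub, sub_neg_eq_add, add_comm]
    exact hdvd

theorem ne_of_sieveCheck_nil {c : ℤ} (hc : |c| < 100) (hs : SieveCheck c []) (p : ℕ) (y : ℤ) :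
    y ^ 2 ≠ 5 * (p : ℤ) ^ 22 + 4 * c := by
  intro h
  obtain ⟨t, ht, -⟩ := exists_target (p := p) (y := y.natAbs) hc hs
    (fun t ht => absurd ht List.not_mem_nil) (by rw [Int.natAbs_sq, h])
  exact List.not_mem_nil ht

/-- The values of `ε * ℓ` for which the sieve leaves no solution. -/
def sievedValues : List ℤ :=
  [-97, -89, -83, -79, -73, -71, -67, -61, -59, -53, -47, -43, -41, -37, -31, -29, -23, -19, -17,
    -13, -11, -7, -5, -3, 3, 7, 13, 17, 23, 31, 37, 43, 47, 53, 59, 61, 67, 73, 79, 83, 97]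

theorem sieveCheck_nil : ∀ c ∈ sievedValues, |c| < 100 ∧ SieveCheck c [] := by decide +kernel

theorem mem_of_prime {ℓ : ℕ} (hℓ : ℓ.Prime) (hodd : Odd ℓ) (hlt : ℓ < 100) {ε : ℤ}
    (hε : ε = 1 ∨ ε = -1) :
    ε * ℓ ∈ sievedValues ∨ ε = 1 ∧ ℓ ∈ [5, 11, 19, 29, 41, 71, 89] := by
  have h2 := hℓ.two_le
  rcases hε with rfl | rfl <;>
  interval_cases ℓ <;>
  first
  | exact absurd hodd (by decide)
  | exact Or.inl (by decide)
  | exact Or.inr (by decide)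
  | (exfalso; revert hℓ; norm_num)

theorem no_points_on_tau_hyperelliptic_curves (ℓ : ℕ) (hℓ : ℓ.Prime)
    (hodd : Odd ℓ) (hlt : ℓ < 100) (ε : ℤ) (hε : ε = 1 ∨ ε = -1)
    (p : ℕ) (hp : p.Prime) (hpodd : Odd p) (y : ℤ) :
    y ^ 2 ≠ 5 * (p : ℤ) ^ 22 + 4 * ε * (ℓ : ℤ) := by
  rcases mem_of_prime hℓ hodd hlt hε with h | ⟨rfl, h⟩
  · rw [mul_assoc]
    exact ne_of_sieveCheck_nil (sieveCheck_nil _ h).1 (sieveCheck_nil _ h).2 p y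
  · rw [mul_one]
    simp only [List.mem_cons, List.not_mem_nil, or_false] at h
    rcases h with rfl | rfl | rfl | rfl | rfl | rfl | rfl
    · exact ne_of_sieveCheck formFive_valid descentFive_valid (y₀ := 5) rfl (by decide)
        (by decide) (by decide +kernel) hp hpodd y
    · exact ne_of_sieveCheck formEleven_valid descentEleven_valid (y₀ := 7) rfl (by decide)
        (by decide) (by decide +kernel) hp hpodd y
    · exact ne_of_sieveCheck formNineteen_valid descentNineteen_valid (y₀ := 9) rfl (by decide)
        (by decide) (by decide +kernel) hp hpodd y
    · exact ne_of_sieveCheck formTwentyNine_valid descentTwentyNine_valid (y₀ := 11) rfl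
        (by decide) (by decide) (by decide +kernel) hp hpodd y
    · exact ne_of_sieveCheck formFortyOne_valid descentFortyOne_valid (y₀ := 13) rfl (by decide)
        (by decide) (by decide +kernel) hp hpodd y
    · exact ne_of_sieveCheck formSeventyOne_valid descentSeventyOne_valid (y₀ := 17) rfl
        (by decide) (by decide) (by decide +kernel) hp hpodd y
    · exact ne_of_sieveCheck formEightyNine_valid descentEightyNine_valid (y₀ := 19) rfl
        (by decide) (by decide) (by decide +kernel) hp hpodd y
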